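/- arXiv:1908.07383 — 2 statements merged into one kernel-verified Lean document; each statement's English description precedes it below -/
import Mathlib

section
/- Let f̃ be a transcendental entire function that is a lift of a transcendental self-map f of ℂ*, i.e. exp(f̃(z)) = f(exp(z)) for all z ∈ ℂ. Let e ∈ {0,∞}^ℕ, let U be a wandering domain of f with U ⊆ Ĩ_e(f), and let V be a connected component of exp⁻¹(U). Then there exists z ∈ ∂V such that for every R > 0 there is N with, for all n ≥ N: Re f̃ⁿ(z) > R whenever e_n = ∞, and Re f̃ⁿ(z) < −R whenever e_n = 0. -/
open Complex Topology Filter Set Function OnePoint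

noncomputable section

/-- The chordal (spherical) distance on the Riemann sphere, restricted to finite points. -/
def chordalDist (z w : ℂ) : ℝ :=
  ‖z - w‖ / Real.sqrt ((1 + ‖z‖ ^ 2) * (1 + ‖w‖ ^ 2))

/-- A transcendental self-map of `ℂ* = ℂ \ {0}`: a holomorphic self-map of the punctured
plane with essential singularities at `0` and `∞`; equivalently, on `ℂ*` it has the form
`z ^ m * exp (g z + h z⁻¹)` for some `m : ℤ` and nonconstant entire functions `g, h`. -/
def IsTranscendentalSelfMapCStar (f : ℂ → ℂ) : Prop :=
  ∃ (m : ℤ) (g h : ℂ → ℂ),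
    Differentiable ℂ g ∧ Differentiable ℂ h ∧
    (¬ ∃ c : ℂ, ∀ z, g z = c) ∧ (¬ ∃ c : ℂ, ∀ z, h z = c) ∧
    ∀ z : ℂ, z ≠ 0 → f z = z ^ m * Complex.exp (g z + h z⁻¹)

/-- The escaping set `I(f)` of a self-map of the punctured plane: points whose orbit
accumulates only at `0` and `∞`. -/
def escapingSet (f : ℂ → ℂ) : Set ℂ :=
  {z | z ≠ 0 ∧ ∀ ε : ℝ, 0 < ε → ∃ N : ℕ, ∀ n ≥ N,
    ‖f^[n] z‖ < ε ∨ 1 / ε < ‖f^[n] z‖}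

/-- The little escaping set `I_e(f)` with essential itinerary `e` (where `true` stands for the
symbol `∞` and `false` for the symbol `0`). -/
def littleEscapingSet (f : ℂ → ℂ) (e : ℕ → Bool) : Set ℂ :=
  {z | z ∈ escapingSet f ∧ ∃ ℓ k : ℕ, ∀ n : ℕ,
    (1 < ‖f^[n + ℓ] z‖ ↔ e (n + k) = true)}

/-- The immediate little escaping set `Ĩ_e(f)`. -/
def immediateLittleEscapingSet (f : ℂ → ℂ) (e : ℕ → Bool) : Set ℂ :=
  {z | z ∈ escapingSet f ∧ ∃ ℓ : ℕ, ∀ n : ℕ,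
    (1 < ‖f^[n + ℓ] z‖ ↔ e (n + ℓ) = true)}

/-- The Fatou set of a self-map of the punctured plane: points of `ℂ*` with a neighbourhood
(inside `ℂ*`) on which the family of iterates is equicontinuous w.r.t. the chordal metric. -/
def FatouSet (f : ℂ → ℂ) : Set ℂ :=
  {z | z ≠ 0 ∧ ∃ U : Set ℂ, IsOpen U ∧ z ∈ U ∧ (∀ w ∈ U, w ≠ 0) ∧
    ∀ w ∈ U, ∀ ε : ℝ, 0 < ε → ∃ δ : ℝ, 0 < δ ∧ ∀ w' ∈ U,
      chordalDist w w' < δ → ∀ n : ℕ, chordalDist (f^[n] w) (f^[n] w') < ε}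

/-- The Julia set `J(f) = ℂ* \ F(f)`. -/
def JuliaSet (f : ℂ → ℂ) : Set ℂ := {z : ℂ | z ≠ 0} \ FatouSet f

/-- A Fatou component: a connected component of the Fatou set. -/
def IsFatouComponent (f : ℂ → ℂ) (U : Set ℂ) : Prop :=
  ∃ z ∈ FatouSet f, U = connectedComponentIn (FatouSet f) z

/-- A wandering domain: a Fatou component `U` such that the Fatou components containing the
iterated images `fⁿ(U)` are pairwise distinct. -/
def IsWanderingDomain (f : ℂ → ℂ) (U : Set ℂ) : Prop :=
  IsFatouComponent f U ∧ ∃ V : ℕ → Set ℂ, V 0 = U ∧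
    (∀ n, IsFatouComponent f (V n)) ∧
    (∀ n, f '' V n ⊆ V (n + 1)) ∧ Function.Injective V

/-- A set is bounded in `ℂ*` if it lies in some closed annulus `{r ≤ |z| ≤ R}`. -/
def BoundedInCStar (X : Set ℂ) : Prop :=
  ∃ r R : ℝ, 0 < r ∧ r ≤ R ∧ X ⊆ {z : ℂ | r ≤ ‖z‖ ∧ ‖z‖ ≤ R}

/-- The boundary of a subset of `ℂ*` taken in `ℂ*`. -/
def boundaryInCStar (G : Set ℂ) : Set ℂ := frontier G \ {0}

/-- The set `I(f) ∪ {0, ∞}` regarded as a subset of the Riemann sphere `ℂ̂ = ℂ ∪ {∞}`. -/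
def escapingSphere (f : ℂ → ℂ) : Set (OnePoint ℂ) :=
  ((fun z : ℂ => (z : OnePoint ℂ)) '' escapingSet f) ∪ {((0 : ℂ) : OnePoint ℂ), ∞}

/-- The set `I_e(f) ∪ {0, ∞}` regarded as a subset of the Riemann sphere. -/
def littleEscapingSphere (f : ℂ → ℂ) (e : ℕ → Bool) : Set (OnePoint ℂ) :=
  ((fun z : ℂ => (z : OnePoint ℂ)) '' littleEscapingSet f e) ∪ {((0 : ℂ) : OnePoint ℂ), ∞}

/-- A subset of the sphere has exactly two connected components. -/
def HasExactlyTwoComponents (K : Set (OnePoint ℂ)) : Prop :=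
  ∃ x ∈ K, ∃ y ∈ K, connectedComponentIn K x ≠ connectedComponentIn K y ∧
    ∀ z ∈ K, connectedComponentIn K z = connectedComponentIn K x ∨
      connectedComponentIn K z = connectedComponentIn K y

/-- A domain `U ⊆ ℂ*` is doubly connected if its complement in the Riemann sphere has
exactly two connected components. -/
def DoublyConnected (U : Set ℂ) : Prop :=
  HasExactlyTwoComponents (((fun z : ℂ => (z : OnePoint ℂ)) '' U)ᶜ)

/-- A transcendental entire function. -/
def IsTranscendentalEntire (f : ℂ → ℂ) : Prop :=
  Differentiable ℂ f ∧ ¬ ∃ p : Polynomial ℂ, ∀ z, f z = p.eval z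

/-- The Fatou set of an entire function. -/
def FatouSetEntire (f : ℂ → ℂ) : Set ℂ :=
  {z | ∃ U : Set ℂ, IsOpen U ∧ z ∈ U ∧
    ∀ w ∈ U, ∀ ε : ℝ, 0 < ε → ∃ δ : ℝ, 0 < δ ∧ ∀ w' ∈ U,
      chordalDist w w' < δ → ∀ n : ℕ, chordalDist (f^[n] w) (f^[n] w') < ε}

/-- The Julia set of an entire function. -/
def JuliaSetEntire (f : ℂ → ℂ) : Set ℂ := (FatouSetEntire f)ᶜ

/-- `f` has a finite asymptotic value. -/
def HasFiniteAsymptoticValue (f : ℂ → ℂ) : Prop :=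
  ∃ (a : ℂ) (γ : ℝ → ℂ), ContinuousOn γ (Set.Ici (0 : ℝ)) ∧
    Tendsto (fun t => ‖γ t‖) atTop atTop ∧
    Tendsto (fun t => f (γ t)) atTop (nhds a)

/-- One-sided second order expansion of `φ` at `c`, where `4 * γ` plays the role of an upper bound
for the Laplacian of `φ` at `c`. -/
def LaplacianBoundAt (φ : ℂ → ℝ) (c : ℂ) (γ : ℝ) : Prop :=
  ∃ α β : ℂ, ∀ η : ℝ, 0 < η → ∀ᶠ h in 𝓝 (0 : ℂ),
    φ (c + h) ≤ φ c + (α * h).re + (β * h ^ 2).re + (γ + η) * ‖h‖ ^ 2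

namespace LaplacianBoundAt

variable {φ ψ : ℂ → ℝ} {c : ℂ} {γ γ' : ℝ}

theorem mono (hφ : LaplacianBoundAt φ c γ) (h : γ ≤ γ') : LaplacianBoundAt φ c γ' := by
  obtain ⟨α, β, H⟩ := hφ
  refine ⟨α, β, fun η hη => (H η hη).mono fun h hh => hh.trans ?_⟩
  gcongr

theorem const (k : ℝ) (c : ℂ) : LaplacianBoundAt (fun _ => k) c 0 := by
  refine ⟨0, 0, fun η hη => Eventually.of_forall fun h => ?_⟩
  simp only [zero_mul, zero_re, add_zero, zero_add]
  have : 0 ≤ η * ‖h‖ ^ 2 := by positivity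
  linarith

theorem add (hφ : LaplacianBoundAt φ c γ) (hψ : LaplacianBoundAt ψ c γ') :
    LaplacianBoundAt (fun z => φ z + ψ z) c (γ + γ') := by
  obtain ⟨α, β, H⟩ := hφ
  obtain ⟨α', β', H'⟩ := hψ
  refine ⟨α + α', β + β', fun η hη => ?_⟩
  filter_upwards [H (η / 2) (half_pos hη), H' (η / 2) (half_pos hη)] with h h1 h2
  simp only [add_mul, add_re] at *
  linarith

theorem const_mul (hφ : LaplacianBoundAt φ c γ) {k : ℝ} (hk : 0 < k) :
    LaplacianBoundAt (fun z => k * φ z) c (k * γ) := by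
  obtain ⟨α, β, H⟩ := hφ
  refine ⟨k * α, k * β, fun η hη => ?_⟩
  filter_upwards [H (η / k) (div_pos hη hk)] with h h1
  have := mul_le_mul_of_nonneg_left h1 hk.le
  rw [mul_assoc, mul_assoc, re_ofReal_mul, re_ofReal_mul]
  refine this.trans (le_of_eq ?_)
  field_simp

theorem sum {ι : Type*} (s : Finset ι) {φ : ι → ℂ → ℝ} {γ : ι → ℝ}
    (hφ : ∀ i ∈ s, LaplacianBoundAt (φ i) c (γ i)) :
    LaplacianBoundAt (fun z => ∑ i ∈ s, φ i z) c (∑ i ∈ s, γ i) := by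
  classical
  induction s using Finset.induction_on with
  | empty => simpa using const 0 c
  | insert i s hi ih =>
    simp only [Finset.sum_insert hi]
    exact (hφ i (Finset.mem_insert_self i s)).add
      (ih fun j hj => hφ j (Finset.mem_insert_of_mem hj))

theorem comp {W : ℂ → ℂ} (hφ : LaplacianBoundAt φ (W c) 0)
    (hW : ∀ᶠ z in 𝓝 c, DifferentiableAt ℂ W z) :
    LaplacianBoundAt (fun z => φ (W z)) c 0 := by
  obtain ⟨α, β, H⟩ := hφ
  set G : ℂ → ℂ := dslope W c with hG
  have hGd : DifferentiableAt ℂ G c := by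
    obtain ⟨s, hs, hso, hcs⟩ := eventually_nhds_iff.1 hW
    have : DifferentiableOn ℂ G s :=
      (Complex.differentiableOn_dslope (hso.mem_nhds hcs)).2
        fun z hz => (hs z hz).differentiableWithinAt
    exact this.differentiableAt (hso.mem_nhds hcs)
  have hWG : ∀ t, W (c + t) = W c + t * G (c + t) := by
    intro t
    have := sub_smul_dslope W c (c + t)
    simp only [smul_eq_mul, add_sub_cancel_left] at this
    rw [hG, this]; ring
  set a := G c
  set b := deriv G c
  have hlit := (hasDerivAt_iff_isLittleO_nhds_zero.1 hGd.hasDerivAt)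
  have hcont : Tendsto (fun t => G (c + t)) (𝓝 0) (𝓝 a) := by
    have : Tendsto (fun t : ℂ => c + t) (𝓝 0) (𝓝 c) := by
      simpa using (continuous_const_add c).tendsto (0 : ℂ)
    exact hGd.continuousAt.tendsto.comp this
  refine ⟨α * a, α * b + β * a ^ 2, fun η hη => ?_⟩
  have hη' : 0 < η / (‖α‖ + ‖β‖ + (‖a‖ + 1) ^ 2) := by positivity
  set e := η / (‖α‖ + ‖β‖ + (‖a‖ + 1) ^ 2) with he
  have hz : Tendsto (fun t => t * G (c + t)) (𝓝 0) (𝓝 0) := by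
    simpa using tendsto_id.mul hcont
  have hsq : Tendsto (fun t => ‖G (c + t) ^ 2 - a ^ 2‖) (𝓝 0) (𝓝 0) := by
    have := ((hcont.pow 2).sub_const (a ^ 2)).norm
    simpa using this
  filter_upwards [hz.eventually (H e hη'), hlit.def hη', hsq.eventually (gt_mem_nhds hη'),
    hcont.norm.eventually (gt_mem_nhds (lt_add_one ‖a‖))] with t h1 h2 h3 h4
  rw [hWG t]
  refine h1.trans ?_
  set g := G (c + t)
  have e1 : (α * (t * g)).re ≤ (α * a * t).re + (α * b * t ^ 2).re + ‖α‖ * e * ‖t‖ ^ 2 := by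
    have : α * (t * g) = α * a * t + α * b * t ^ 2 + α * (t * (g - a - t • b)) := by
      simp only [smul_eq_mul]; ring
    rw [this, add_re, add_re]
    gcongr
    refine (re_le_norm _).trans ?_
    rw [norm_mul, norm_mul]
    calc ‖α‖ * (‖t‖ * ‖g - a - t • b‖) ≤ ‖α‖ * (‖t‖ * (e * ‖t‖)) := by gcongr
      _ = _ := by ring
  have e2 : (β * (t * g) ^ 2).re ≤ (β * a ^ 2 * t ^ 2).re + ‖β‖ * e * ‖t‖ ^ 2 := by
    have : β * (t * g) ^ 2 = β * a ^ 2 * t ^ 2 + β * ((g ^ 2 - a ^ 2) * t ^ 2) := by ring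
    rw [this, add_re]
    gcongr
    refine (re_le_norm _).trans ?_
    rw [norm_mul, norm_mul, norm_pow]
    calc ‖β‖ * (‖g ^ 2 - a ^ 2‖ * ‖t‖ ^ 2) ≤ ‖β‖ * (e * ‖t‖ ^ 2) := by gcongr
      _ = _ := by ring
  have e3 : (0 + e) * ‖t * g‖ ^ 2 ≤ (‖a‖ + 1) ^ 2 * e * ‖t‖ ^ 2 := by
    rw [norm_mul, zero_add]
    calc e * (‖t‖ * ‖g‖) ^ 2 ≤ e * (‖t‖ * (‖a‖ + 1)) ^ 2 := by gcongr
      _ = _ := by ring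
  have e4 : (0 + η) * ‖t‖ ^ 2 = (‖α‖ + ‖β‖ + (‖a‖ + 1) ^ 2) * e * ‖t‖ ^ 2 := by
    rw [he]; field_simp; ring
  rw [e4, add_mul (α * b), add_re]
  linarith

theorem radial {θ : ℝ → ℝ} {p q : ℝ} (w ζ : ℂ)
    (hθ : ∀ η : ℝ, 0 < η → ∀ᶠ s in 𝓝 (0 : ℝ),
      θ (‖w - ζ‖ ^ 2 + s) ≤ θ (‖w - ζ‖ ^ 2) + p * s + (q + η) * s ^ 2) :
    LaplacianBoundAt (fun z => θ (‖z - ζ‖ ^ 2)) w (p + 2 * q * ‖w - ζ‖ ^ 2) := by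
  set d := w - ζ with hd
  set cd := (starRingEnd ℂ) d with hcd
  refine ⟨2 * p * cd, 2 * q * cd ^ 2, fun η hη => ?_⟩
  have hη' : 0 < η / (2 * (2 * ‖d‖ + 1) ^ 2) := by positivity
  set e := η / (2 * (2 * ‖d‖ + 1) ^ 2) with he
  have hs : Tendsto (fun h : ℂ => 2 * (cd * h).re + ‖h‖ ^ 2) (𝓝 0) (𝓝 0) := by
    have : Continuous (fun h : ℂ => 2 * (cd * h).re + ‖h‖ ^ 2) := by fun_prop
    simpa using this.tendsto 0
  have hr : Tendsto (fun h : ℂ => |q| * (4 * ‖d‖ * ‖h‖ + ‖h‖ ^ 2)) (𝓝 0) (𝓝 0) := by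
    have : Continuous (fun h : ℂ => |q| * (4 * ‖d‖ * ‖h‖ + ‖h‖ ^ 2)) := by fun_prop
    simpa using this.tendsto 0
  have hn : Tendsto (fun h : ℂ => ‖h‖) (𝓝 0) (𝓝 0) := by
    simpa using (continuous_norm (E := ℂ)).tendsto 0
  filter_upwards [hs.eventually (hθ e hη'), hr.eventually (gt_mem_nhds (half_pos hη)),
    hn.eventually (gt_mem_nhds one_pos)] with h h1 h2 h3
  have hnorm : ‖w + h - ζ‖ ^ 2 = ‖d‖ ^ 2 + (2 * (cd * h).re + ‖h‖ ^ 2) := by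
    have : w + h - ζ = d + h := by rw [hd]; ring
    rw [this, ← normSq_eq_norm_sq, ← normSq_eq_norm_sq, ← normSq_eq_norm_sq, normSq_add,
      ← conj_re (d * _)]
    simp [hcd]; ring
  rw [hnorm]
  refine h1.trans ?_
  set x := (cd * h).re with hx
  have hxle : |x| ≤ ‖d‖ * ‖h‖ := by
    refine (abs_re_le_norm _).trans ?_
    rw [norm_mul, hcd, RCLike.norm_conj]
  have hx2 : 4 * x ^ 2 = 2 * ‖d‖ ^ 2 * ‖h‖ ^ 2 + 2 * (cd ^ 2 * h ^ 2).re := by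
    rw [← mul_pow]
    have : ‖d‖ ^ 2 * ‖h‖ ^ 2 = normSq (cd * h) := by
      rw [normSq_mul, hcd, normSq_conj, normSq_eq_norm_sq, normSq_eq_norm_sq]
    rw [mul_assoc, this, sq (cd * h), mul_re, normSq_apply]; ring
  have t1 : (2 * (p : ℂ) * cd * h).re = 2 * p * x := by
    have : 2 * (p : ℂ) * cd * h = ((2 * p : ℝ) : ℂ) * (cd * h) := by push_cast; ring
    rw [this, re_ofReal_mul]
  have t2 : (2 * (q : ℂ) * cd ^ 2 * h ^ 2).re = 2 * q * (cd ^ 2 * h ^ 2).re := by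
    have : 2 * (q : ℂ) * cd ^ 2 * h ^ 2 = ((2 * q : ℝ) : ℂ) * (cd ^ 2 * h ^ 2) := by
      push_cast; ring
    rw [this, re_ofReal_mul]
  have t3 : q * (4 * x * ‖h‖ ^ 2 + ‖h‖ ^ 4) ≤ η / 2 * ‖h‖ ^ 2 := by
    calc q * (4 * x * ‖h‖ ^ 2 + ‖h‖ ^ 4) ≤ |q * (4 * x * ‖h‖ ^ 2 + ‖h‖ ^ 4)| := le_abs_self _
      _ = |q| * |4 * x + ‖h‖ ^ 2| * ‖h‖ ^ 2 := by
        rw [show q * (4 * x * ‖h‖ ^ 2 + ‖h‖ ^ 4) = q * (4 * x + ‖h‖ ^ 2) * ‖h‖ ^ 2 by ring,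
          abs_mul, abs_mul, abs_of_nonneg (by positivity : 0 ≤ ‖h‖ ^ 2)]
      _ ≤ |q| * (4 * ‖d‖ * ‖h‖ + ‖h‖ ^ 2) * ‖h‖ ^ 2 := by
        gcongr
        refine (abs_add_le _ _).trans ?_
        rw [abs_mul, abs_of_nonneg (by positivity : 0 ≤ ‖h‖ ^ 2),
          abs_of_pos (by norm_num : (0 : ℝ) < 4)]
        nlinarith
      _ ≤ _ := by gcongr
  have t4 : e * (2 * x + ‖h‖ ^ 2) ^ 2 ≤ η / 2 * ‖h‖ ^ 2 := by
    have hb : |2 * x + ‖h‖ ^ 2| ≤ (2 * ‖d‖ + 1) * ‖h‖ := by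
      refine (abs_add_le _ _).trans ?_
      rw [abs_mul, abs_of_nonneg (by positivity : 0 ≤ ‖h‖ ^ 2),
          abs_of_pos (by norm_num : (0 : ℝ) < 2)]
      nlinarith [norm_nonneg h]
    calc e * (2 * x + ‖h‖ ^ 2) ^ 2 = e * |2 * x + ‖h‖ ^ 2| ^ 2 := by rw [sq_abs]
      _ ≤ e * ((2 * ‖d‖ + 1) * ‖h‖) ^ 2 := by gcongr
      _ = _ := by rw [he]; field_simp
  rw [t1, t2]
  have key : q * (2 * x + ‖h‖ ^ 2) ^ 2 = q * (2 * ‖d‖ ^ 2 * ‖h‖ ^ 2 + 2 * (cd ^ 2 * h ^ 2).re)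
      + q * (4 * x * ‖h‖ ^ 2 + ‖h‖ ^ 4) := by
    rw [← hx2]; ring
  nlinarith

end LaplacianBoundAt

theorem log_add_quadratic_bound {D : ℝ} (hD : 0 < D) {η : ℝ} (hη : 0 < η) :
    ∀ᶠ s in 𝓝 (0 : ℝ),
      |Real.log (D + s) - (Real.log D + 1 / D * s - 1 / (2 * D ^ 2) * s ^ 2)| ≤ η * s ^ 2 := by
  have hc : Tendsto (fun s : ℝ => |s / D|) (𝓝 0) (𝓝 0) := by
    have : Continuous fun s : ℝ => |s / D| := by fun_prop
    simpa using this.tendsto 0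
  have h2 : 0 < η * D ^ 2 / 2 := by positivity
  filter_upwards [hc.eventually (gt_mem_nhds h2), hc.eventually (gt_mem_nhds one_half_pos)]
    with s h1 h2
  have hx : |-(s / D)| < 1 := by rw [abs_neg]; linarith
  have key := Real.abs_log_sub_add_sum_range_le hx 2
  have hlog : Real.log (D + s) = Real.log D + Real.log (1 - -(s / D)) := by
    have hpos : 0 < 1 - -(s / D) := by linarith [(abs_lt.1 hx).2]
    rw [← Real.log_mul hD.ne' hpos.ne']
    congr 1; field_simp; ring
  rw [abs_neg] at key
  have hle : |s / D| ^ (2 + 1) / (1 - |s / D|) ≤ η * s ^ 2 := by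
    rw [div_le_iff₀ (by linarith)]
    have hs2 : s ^ 2 = D ^ 2 * |s / D| ^ 2 := by rw [sq_abs]; field_simp
    rw [hs2, pow_succ]
    have : 0 ≤ |s / D| ^ 2 := by positivity
    nlinarith [mul_nonneg this (by linarith : 0 ≤ η * D ^ 2 / 2 - |s / D|),
      mul_nonneg (mul_nonneg this (by positivity : 0 ≤ η * D ^ 2)) (by linarith : 0 ≤ 1/2 - |s / D|)]
  refine le_trans (le_of_eq ?_) (key.trans hle)
  rw [hlog]
  congr 1
  simp [Finset.sum_range_succ]
  field_simp
  ring

theorem IsCompact.exists_finset_packing {K U : Set ℂ} (hK : IsCompact K) (hU : IsOpen U)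
    (hKU : K ⊆ U) (hfin : MeasureTheory.volume U ≠ ⊤) :
    ∃ ε : ℝ, 0 < ε ∧ ε ≤ 1 ∧ ∃ T : Finset ℂ, (T : Set ℂ) ⊆ K ∧
      (∀ w ∈ K, ∃ ζ ∈ T, ‖w - ζ‖ ≤ ε) ∧
      T.card * ε ^ 2 ≤ 16 * (MeasureTheory.volume U).toReal := by
  obtain ⟨ε₀, hε₀, hthick⟩ := hK.exists_cthickening_subset_open hU hKU
  set ε := min ε₀ 1 with hε
  have hεpos : 0 < ε := lt_min hε₀ one_pos
  have hball : ∀ x ∈ K, Metric.closedBall x (ε / 4) ⊆ U := fun x hx =>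
    ((Metric.closedBall_subset_closedBall (by linarith [min_le_left ε₀ 1])).trans
      (Metric.closedBall_subset_cthickening hx ε₀)).trans hthick
  obtain ⟨u, huK, hdisj, hcov⟩ := Vitali.exists_disjoint_subfamily_covering_enlargement_closedBall
    K (fun x : ℂ => x) (fun _ => ε / 4) (ε / 4) (fun _ _ => le_rfl) 4 (by norm_num)
  have hcard : ∀ T : Finset ℂ, (T : Set ℂ) ⊆ u →
      T.card * ε ^ 2 ≤ 16 * (MeasureTheory.volume U).toReal := by
    intro T hT
    have h1 : ∑ x ∈ T, MeasureTheory.volume (Metric.closedBall x (ε / 4))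
        ≤ MeasureTheory.volume U := by
      rw [← MeasureTheory.measure_biUnion_finset (hdisj.subset hT)
        fun _ _ => measurableSet_closedBall]
      exact MeasureTheory.measure_mono (iUnion₂_subset fun x hx => hball x (huK (hT hx)))
    have h2 := ENNReal.toReal_mono hfin h1
    have h3 : ∀ x : ℂ, (MeasureTheory.volume (Metric.closedBall x (ε / 4))).toReal
        = (ε / 4) ^ 2 * Real.pi := by
      intro x
      rw [Complex.volume_closedBall, ENNReal.toReal_mul, ENNReal.toReal_pow,
        ENNReal.toReal_ofReal (by positivity)]
      rfl
    rw [ENNReal.toReal_sum fun x _ => (MeasureTheory.measure_closedBall_lt_top).ne,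
      Finset.sum_congr rfl fun x _ => h3 x, Finset.sum_const, nsmul_eq_mul] at h2
    have h4 : (T.card : ℝ) * ε ^ 2 ≤ T.card * ε ^ 2 * Real.pi :=
      le_mul_of_one_le_right (by positivity) (by linarith [Real.pi_gt_three])
    nlinarith
  have hufin : u.Finite := by
    by_contra hinf
    obtain ⟨n, hn⟩ := exists_nat_gt (16 * (MeasureTheory.volume U).toReal / ε ^ 2)
    obtain ⟨T, hT, hTn⟩ := Set.Infinite.exists_subset_card_eq hinf n
    have := hcard T hT
    rw [hTn] at this
    rw [div_lt_iff₀ (by positivity)] at hn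
    linarith
  refine ⟨ε, hεpos, min_le_right _ _, hufin.toFinset, by simpa using huK, fun w hw => ?_,
    hcard _ (by simp)⟩
  obtain ⟨b, hb, hsub⟩ := hcov w hw
  refine ⟨b, by simpa using hb, ?_⟩
  have := hsub (Metric.mem_closedBall_self (by positivity))
  rw [Metric.mem_closedBall, dist_eq_norm] at this
  linarith

theorem laplacianBoundAt_cutoff (q w : ℂ) {δ : ℝ} :
    LaplacianBoundAt (fun z => (max (‖z - q‖ ^ 2 - δ ^ 2) 0) ^ 2) w
      (if ‖w - q‖ ^ 2 < δ ^ 2 then 0 else 4 * ‖w - q‖ ^ 2) := by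
  split_ifs with h
  · refine (LaplacianBoundAt.radial (θ := fun s => (max (s - δ ^ 2) 0) ^ 2) (p := 0) (q := 0)
      w q fun η hη => ?_).mono (by simp)
    have : 0 < δ ^ 2 - ‖w - q‖ ^ 2 := by linarith
    filter_upwards [gt_mem_nhds this] with s hs
    rw [max_eq_right (by linarith)]
    have : 0 ≤ (max (‖w - q‖ ^ 2 - δ ^ 2) 0) ^ 2 := by positivity
    have : 0 ≤ η * s ^ 2 := by positivity
    simp
    linarith
  · push Not at h
    refine (LaplacianBoundAt.radial (θ := fun s => (max (s - δ ^ 2) 0) ^ 2)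
      (p := 2 * (‖w - q‖ ^ 2 - δ ^ 2)) (q := 1)
      w q fun η hη => Eventually.of_forall fun s => ?_).mono (by nlinarith [sq_nonneg δ])
    rw [max_eq_left (by linarith : 0 ≤ ‖w - q‖ ^ 2 - δ ^ 2)]
    have h0 : (max (‖w - q‖ ^ 2 + s - δ ^ 2) 0) ^ 2 ≤ (‖w - q‖ ^ 2 + s - δ ^ 2) ^ 2 := by
      rcases max_cases (‖w - q‖ ^ 2 + s - δ ^ 2) 0 with h | h <;> rw [h.1]
      nlinarith [sq_nonneg (‖w - q‖ ^ 2 + s - δ ^ 2)]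
    have : 0 ≤ η * s ^ 2 := by positivity
    nlinarith

theorem laplacianBoundAt_neg_log (ζ w : ℂ) {ε : ℝ} (hε : 0 < ε) (L : ℝ) :
    LaplacianBoundAt (fun z => L - Real.log (‖z - ζ‖ ^ 2 + ε ^ 2)) w
      (-(ε ^ 2 / (‖w - ζ‖ ^ 2 + ε ^ 2) ^ 2)) := by
  have hD : 0 < ‖w - ζ‖ ^ 2 + ε ^ 2 := by positivity
  refine (LaplacianBoundAt.radial (θ := fun s => L - Real.log (s + ε ^ 2))
      (p := - (1 / (‖w - ζ‖ ^ 2 + ε ^ 2))) (q := 1 / (2 * (‖w - ζ‖ ^ 2 + ε ^ 2) ^ 2))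
      w ζ fun η hη => ?_).mono (le_of_eq ?_)
  · filter_upwards [log_add_quadratic_bound hD hη] with s hs
    have := (abs_le.1 hs).1
    rw [show ‖w - ζ‖ ^ 2 + s + ε ^ 2 = ‖w - ζ‖ ^ 2 + ε ^ 2 + s by ring]
    linarith
  · field_simp; ring

theorem laplacianBoundAt_log (ζ w : ℂ) (h : w ≠ ζ) (L : ℝ) :
    LaplacianBoundAt (fun z => Real.log (‖z - ζ‖ ^ 2) - L) w 0 := by
  have hD : 0 < ‖w - ζ‖ := norm_pos_iff.2 (sub_ne_zero.2 h)
  refine (LaplacianBoundAt.radial (θ := fun s => Real.log s - L)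
      (p := 1 / ‖w - ζ‖ ^ 2) (q := - (1 / (2 * (‖w - ζ‖ ^ 2) ^ 2)))
      w ζ fun η hη => ?_).mono (le_of_eq ?_)
  · filter_upwards [log_add_quadratic_bound (by positivity : 0 < ‖w - ζ‖ ^ 2) hη] with s hs
    have := (abs_le.1 hs).2
    linarith
  · field_simp; ring

/-- A nonnegative function, superharmonic on the compact set `K`, that is at least `1` away from
`q` and whose size close to `q` is controlled by the area of a neighbourhood of `K`. -/
theorem exists_barrier {M δ : ℝ} (hM : 0 < M) (hδ : 0 < δ) :
    ∃ C : ℝ, ∀ (q : ℂ) (U K : Set ℂ), ‖q‖ ≤ M → IsOpen U →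
      U ⊆ Metric.closedBall 0 M → IsCompact K → K ⊆ U →
      ∃ ψ : ℂ → ℝ, Continuous ψ ∧ (∀ w ∈ U, 0 ≤ ψ w) ∧
        (∀ w ∈ U, 2 * δ ≤ ‖w - q‖ → 1 ≤ ψ w) ∧
        (∀ w ∈ K, LaplacianBoundAt ψ w 0) ∧
        ∀ w, ‖w - q‖ ≤ δ / 2 → ψ w ≤ C * (MeasureTheory.volume U).toReal := by
  set L := Real.log (4 * M ^ 2 + 1) with hL
  set E := |L - Real.log ((δ / 2) ^ 2)| with hE
  refine ⟨1 / (9 * δ ^ 4) * (64 * M ^ 2 * 16 * E), fun q U K hq hU hUM hK hKU => ?_⟩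
  have hfin : MeasureTheory.volume U ≠ ⊤ :=
    (MeasureTheory.measure_mono hUM |>.trans_lt MeasureTheory.measure_closedBall_lt_top).ne
  have hUn : ∀ w ∈ U, ‖w‖ ≤ M := fun w hw => by simpa using hUM hw
  have hS : IsCompact (K ∩ {w | δ ≤ ‖w - q‖}) :=
    hK.inter_right (isClosed_le continuous_const (by fun_prop))
  obtain ⟨ε, hε, hε1, T, hTS, hTcov, hTcard⟩ :=
    hS.exists_finset_packing hU (inter_subset_left.trans hKU) hfin
  have hk : ∀ ζ ∈ T, ∀ w ∈ U, 0 ≤ L - Real.log (‖w - ζ‖ ^ 2 + ε ^ 2) := by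
    intro ζ hζ w hw
    have h1 : ‖w - ζ‖ ≤ 2 * M :=
      (norm_sub_le _ _).trans (by linarith [hUn w hw, hUn ζ (hKU (hTS hζ).1)])
    have h2 : ‖w - ζ‖ ^ 2 + ε ^ 2 ≤ 4 * M ^ 2 + 1 := by
      nlinarith [norm_nonneg (w - ζ)]
    have := Real.log_le_log (by positivity) h2
    linarith
  refine ⟨fun w => 1 / (9 * δ ^ 4) * ((max (‖w - q‖ ^ 2 - δ ^ 2) 0) ^ 2 +
    64 * M ^ 2 * ε ^ 2 * ∑ ζ ∈ T, (L - Real.log (‖w - ζ‖ ^ 2 + ε ^ 2))), ?_, ?_, ?_, ?_, ?_⟩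
  · refine continuous_const.mul (Continuous.add (by fun_prop) (continuous_const.mul ?_))
    refine continuous_finsetSum _ fun ζ _ => continuous_const.sub ?_
    exact Continuous.log (by fun_prop) fun w => by positivity
  · intro w hw
    have := Finset.sum_nonneg fun ζ hζ => hk ζ hζ w hw
    positivity
  · intro w hw hwq
    have h1 := Finset.sum_nonneg fun ζ hζ => hk ζ hζ w hw
    have h2 : 3 * δ ^ 2 ≤ max (‖w - q‖ ^ 2 - δ ^ 2) 0 :=
      le_max_of_le_left (by nlinarith)
    have h3 : (3 * δ ^ 2) ^ 2 ≤ (max (‖w - q‖ ^ 2 - δ ^ 2) 0) ^ 2 := by gcongr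
    have h4 : 0 ≤ 64 * M ^ 2 * ε ^ 2 * ∑ ζ ∈ T, (L - Real.log (‖w - ζ‖ ^ 2 + ε ^ 2)) := by
      positivity
    beta_reduce
    rw [div_mul_eq_mul_div, le_div_iff₀ (by positivity)]
    nlinarith
  · intro w hw
    have h1 := laplacianBoundAt_cutoff q w (δ := δ)
    have h2 := LaplacianBoundAt.sum T fun ζ _ => laplacianBoundAt_neg_log ζ w hε L
    have h3 := (h1.add (h2.const_mul (by positivity : 0 < 64 * M ^ 2 * ε ^ 2))).const_mul
      (by positivity : 0 < 1 / (9 * δ ^ 4))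
    refine h3.mono (mul_nonpos_of_nonneg_of_nonpos (by positivity) ?_)
    have hneg : ∀ ζ ∈ T, -(ε ^ 2 / (‖w - ζ‖ ^ 2 + ε ^ 2) ^ 2) ≤ 0 := fun ζ _ =>
      neg_nonpos.2 (by positivity)
    split_ifs with hlt
    · rw [zero_add]
      exact mul_nonpos_of_nonneg_of_nonpos (by positivity) (Finset.sum_nonpos hneg)
    · have hδw : δ ≤ ‖w - q‖ := by
        push Not at hlt
        exact le_of_sq_le_sq hlt (norm_nonneg _)
      obtain ⟨ζ, hζ, hwζ⟩ := hTcov w ⟨hw, hδw⟩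
      have h4 : ∑ ζ ∈ T, -(ε ^ 2 / (‖w - ζ‖ ^ 2 + ε ^ 2) ^ 2)
          ≤ -(ε ^ 2 / (‖w - ζ‖ ^ 2 + ε ^ 2) ^ 2) := by
        rw [← Finset.add_sum_erase T _ hζ]
        have := Finset.sum_nonpos fun ζ' (h : ζ' ∈ T.erase ζ) =>
          hneg ζ' (Finset.mem_of_mem_erase h)
        linarith
      have h5 : 1 / (4 * ε ^ 2) ≤ ε ^ 2 / (‖w - ζ‖ ^ 2 + ε ^ 2) ^ 2 := by
        have : ‖w - ζ‖ ^ 2 ≤ ε ^ 2 := by gcongr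
        rw [div_le_div_iff₀ (by positivity) (by positivity)]
        nlinarith [sq_nonneg (‖w - ζ‖)]
      have h6 : ‖w - q‖ ≤ 2 * M := (norm_sub_le _ _).trans (by linarith [hUn w (hKU hw)])
      have h7 : ‖w - q‖ ^ 2 ≤ (2 * M) ^ 2 := by gcongr
      calc _ ≤ 4 * (2 * M) ^ 2 + 64 * M ^ 2 * ε ^ 2 * -(1 / (4 * ε ^ 2)) := by
            gcongr
            linarith
        _ = 0 := by field_simp; ring
  · intro w hwq
    have h0 : max (‖w - q‖ ^ 2 - δ ^ 2) 0 = 0 :=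
      max_eq_right (by nlinarith [norm_nonneg (w - q)])
    have h1 : ∀ ζ ∈ T, L - Real.log (‖w - ζ‖ ^ 2 + ε ^ 2) ≤ E := by
      intro ζ hζ
      have h2 : δ / 2 ≤ ‖w - ζ‖ := by
        have h3 : δ ≤ ‖ζ - q‖ := (hTS hζ).2
        have h4 := norm_sub_le (w - q) (w - ζ)
        rw [show w - q - (w - ζ) = ζ - q by ring] at h4
        linarith
      have h3 : (δ / 2) ^ 2 ≤ ‖w - ζ‖ ^ 2 + ε ^ 2 := by nlinarith
      have := Real.log_le_log (by positivity) h3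
      exact le_trans (by linarith) (le_abs_self _)
    have h2 := Finset.sum_le_card_nsmul T _ _ h1
    rw [nsmul_eq_mul] at h2
    have hEn : 0 ≤ E := abs_nonneg _
    calc 1 / (9 * δ ^ 4) * ((max (‖w - q‖ ^ 2 - δ ^ 2) 0) ^ 2 +
          64 * M ^ 2 * ε ^ 2 * ∑ ζ ∈ T, (L - Real.log (‖w - ζ‖ ^ 2 + ε ^ 2)))
        ≤ 1 / (9 * δ ^ 4) * (0 ^ 2 + 64 * M ^ 2 * ε ^ 2 * (T.card * E)) := by rw [h0]; gcongr
      _ = 1 / (9 * δ ^ 4) * (64 * M ^ 2 * E * (T.card * ε ^ 2)) := by ring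
      _ ≤ 1 / (9 * δ ^ 4) * (64 * M ^ 2 * E * (16 * (MeasureTheory.volume U).toReal)) := by
        gcongr
      _ = _ := by ring

/-- Minimum principle. -/
theorem IsCompact.exists_notMem_interior_lt_one {K : Set ℂ} (hK : IsCompact K) {Φ : ℂ → ℝ}
    (hΦ : ContinuousOn Φ K) (hsup : ∀ c ∈ interior K, LaplacianBoundAt Φ c 0) {z₀ : ℂ}
    (hz₀ : z₀ ∈ K) (hlt : Φ z₀ < 1) : ∃ c ∈ K, c ∉ interior K ∧ Φ c < 1 := by
  obtain ⟨B, hB⟩ := hK.isBounded.exists_norm_le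
  have hη : 0 < (1 - Φ z₀) / (B ^ 2 + 1) := div_pos (by linarith) (by positivity)
  set η := (1 - Φ z₀) / (B ^ 2 + 1) with hηdef
  obtain ⟨c, hcK, hmin⟩ := hK.exists_isMinOn ⟨z₀, hz₀⟩
    (hΦ.sub (by fun_prop : Continuous fun z : ℂ => η * ‖z‖ ^ 2).continuousOn)
  have hmin' : ∀ z ∈ K, Φ c - η * ‖c‖ ^ 2 ≤ Φ z - η * ‖z‖ ^ 2 := fun z hz => hmin hz
  refine ⟨c, hcK, fun hci => ?_, ?_⟩
  · obtain ⟨α, β, H⟩ := hsup c hci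
    have hK' : ∀ᶠ h in 𝓝 (0 : ℂ), c + h ∈ K := by
      have : Tendsto (fun h : ℂ => c + h) (𝓝 0) (𝓝 c) := by
        simpa using (continuous_const_add c).tendsto (0 : ℂ)
      exact this.eventually (mem_interior_iff_mem_nhds.1 hci)
    obtain ⟨r, hr, hball⟩ := Metric.eventually_nhds_iff.1 ((H (η / 2) (half_pos hη)).and hK')
    have hs : 0 < r / 2 := half_pos hr
    set s := r / 2 with hsdef
    have key : ∀ h : ℂ, ‖h‖ = s → η * (2 * ((starRingEnd ℂ) c * h).re) + η * s ^ 2 ≤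
        (α * h).re + (β * h ^ 2).re + η / 2 * s ^ 2 := by
      intro h hh
      obtain ⟨h1, h2⟩ := hball (y := h) (by rw [dist_zero_right, hh]; linarith)
      have h3 := hmin' _ h2
      have hnorm : ‖c + h‖ ^ 2 = ‖c‖ ^ 2 + 2 * ((starRingEnd ℂ) c * h).re + ‖h‖ ^ 2 := by
        rw [← normSq_eq_norm_sq, ← normSq_eq_norm_sq, ← normSq_eq_norm_sq, normSq_add,
          ← conj_re (c * _)]
        simp; ring
      rw [hnorm, hh] at h3
      rw [hh] at h1
      linarith
    have k1 := key s (by simp [abs_of_pos hs])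
    have k2 := key (-s) (by simp [abs_of_pos hs])
    have k3 := key (s * I) (by simp [abs_of_pos hs])
    have k4 := key (-(s * I)) (by simp [abs_of_pos hs])
    have hsq : ((s : ℂ) * I) ^ 2 = -(s : ℂ) ^ 2 := by rw [mul_pow, I_sq]; ring
    simp only [neg_sq, mul_neg, neg_re, hsq] at k1 k2 k3 k4
    have : 0 < η * s ^ 2 := by positivity
    linarith
  · have h1 := hmin' z₀ hz₀
    have h2 : ‖c‖ ^ 2 ≤ B ^ 2 := by gcongr; exact hB c hcK
    have h3 : η * (B ^ 2 + 1) = 1 - Φ z₀ := by rw [hηdef]; field_simp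
    nlinarith [sq_nonneg ‖z₀‖]

theorem exists_frontier_forall_norm_sub_le {V : Set ℂ} (hV : IsOpen V) {z₀ : ℂ} (hz₀ : z₀ ∈ V)
    {a : ℂ} {ρ : ℝ} (hρ : 0 < ρ) (ha : ∀ z ∈ V, ρ ≤ ‖z - a‖) {M : ℝ} (hM : 0 < M)
    {W : ℕ → ℂ → ℂ} (hWd : ∀ n, DifferentiableOn ℂ (W n) V)
    (hWc : ∀ n, ContinuousOn (W n) (closure V))
    {O : ℕ → Set ℂ} (hO : ∀ n, IsOpen (O n)) (hdisj : Pairwise (Disjoint on O))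
    (hOM : ∀ n, O n ⊆ Metric.closedBall 0 M) (hWO : ∀ n, MapsTo (W n) V (O n))
    {q : ℕ → ℂ} (hq : ∀ n, ‖q n‖ ≤ M)
    (hlim : Tendsto (fun n => ‖W n z₀ - q n‖) atTop (𝓝 0)) :
    ∃ c ∈ frontier V, ∀ δ : ℝ, 0 < δ → ∃ N, ∀ n ≥ N, ‖W n c - q n‖ ≤ 2 * δ := by
  set A : ℕ → ℝ := fun n => (MeasureTheory.volume (O n)).toReal with hA
  have hAsum : Summable A := by
    refine ENNReal.summable_toReal ?_
    rw [← MeasureTheory.measure_iUnion hdisj fun n => (hO n).measurableSet]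
    exact ((MeasureTheory.measure_mono (iUnion_subset hOM)).trans_lt
      MeasureTheory.measure_closedBall_lt_top).ne
  set d : ℕ → ℝ := fun m => 1 / ((m : ℝ) + 1) with hd
  have hdpos : ∀ m, 0 < d m := fun m => Nat.one_div_pos_of_nat
  choose C hC using fun m => exists_barrier hM (hdpos m)
  have hN : ∀ m, ∃ N : ℕ, (∀ n ≥ N, ‖W n z₀ - q n‖ ≤ d m / 2) ∧
      ∀ t : Finset ℕ, (∀ n ∈ t, N ≤ n) → ∑ n ∈ t, C m * A n < (1 / 2) ^ (m + 2) := by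
    intro m
    obtain ⟨N₁, hN₁⟩ := eventually_atTop.1 (hlim.eventually (ge_mem_nhds (half_pos (hdpos m))))
    obtain ⟨s, hs⟩ := summable_iff_vanishing_norm.1 (hAsum.mul_left (C m)) ((1 / 2) ^ (m + 2))
      (by positivity)
    refine ⟨max N₁ (s.sup id + 1), fun n hn => hN₁ n (le_of_max_le_left hn), fun t ht => ?_⟩
    refine (le_abs_self _).trans_lt (hs t (Finset.disjoint_left.2 fun n hnt hns => ?_))
    have h1 := le_of_max_le_right (ht n hnt)
    have h2 : n ≤ s.sup id := Finset.le_sup (f := id) hns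
    omega
  choose N hN₁ hN₂ using hN
  have haV : a ∈ Vᶜ := fun h => by simpa using (ha a h).trans_lt' hρ
  have hne : (Vᶜ).Nonempty := ⟨a, haV⟩
  have hr₀ : 0 < Metric.infDist z₀ Vᶜ :=
    (hV.isClosed_compl.notMem_iff_infDist_pos hne).1 (by simpa using hz₀)
  set r₀ := Metric.infDist z₀ Vᶜ with hr₀def
  set r : ℕ → ℝ := fun k => r₀ * d k with hr
  have hrpos : ∀ k, 0 < r k := fun k => mul_pos hr₀ (hdpos k)
  have hlogρ : ∀ z ∈ V, 0 ≤ Real.log (‖z - a‖ ^ 2) - Real.log (ρ ^ 2) := fun z hz => by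
    have := Real.log_le_log (by positivity) (pow_le_pow_left₀ hρ.le (ha z hz) 2)
    linarith
  obtain ⟨L, hL1, hL2⟩ : ∃ L : ℝ, ‖z₀ - a‖ ≤ L ∧
      4 * (Real.log (‖z₀ - a‖ ^ 2) - Real.log (ρ ^ 2)) + 1 ≤ Real.log (L ^ 2) - Real.log (ρ ^ 2) := by
    have h1 : Tendsto (fun L : ℝ => Real.log (L ^ 2)) atTop atTop :=
      Real.tendsto_log_atTop.comp (tendsto_pow_atTop two_ne_zero)
    obtain ⟨L, h⟩ := ((eventually_ge_atTop ‖z₀ - a‖).and (h1.eventually_ge_atTop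
      (4 * (Real.log (‖z₀ - a‖ ^ 2) - Real.log (ρ ^ 2)) + 1 + Real.log (ρ ^ 2)))).exists
    exact ⟨L, h.1, by linarith [h.2]⟩
  have hΛ : 0 < Real.log (L ^ 2) - Real.log (ρ ^ 2) := by linarith [hlogρ z₀ hz₀]
  set Λ := Real.log (L ^ 2) - Real.log (ρ ^ 2) with hΛdef
  have hstep : ∀ k : ℕ, ∃ c ∈ V, ‖c - a‖ ≤ L ∧ Metric.infDist c Vᶜ ≤ r k ∧
      ∀ m < k, ∀ n < k, N m ≤ n → ‖W n c - q n‖ ≤ 2 * d m := by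
    intro k
    set K : Set ℂ := {z | r k ≤ Metric.infDist z Vᶜ} ∩ Metric.closedBall a L with hKdef
    have hdist : Continuous fun z => Metric.infDist z Vᶜ := Metric.continuous_infDist_pt _
    have hK : IsCompact K :=
      (isCompact_closedBall a L).inter_left (isClosed_le continuous_const hdist)
    have hKV : K ⊆ V := by
      intro z hz
      by_contra h
      have := Metric.infDist_zero_of_mem (show z ∈ Vᶜ from h)
      have h2 : r k ≤ Metric.infDist z Vᶜ := hz.1
      linarith [hrpos k]
    have hz₀K : z₀ ∈ K := by
      refine ⟨?_, by simpa [dist_eq_norm] using hL1⟩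
      have : d k ≤ 1 := by
        simp only [hd]
        rw [div_le_one (by positivity)]
        linarith [(Nat.cast_nonneg k : (0 : ℝ) ≤ k)]
      exact mul_le_of_le_one_right hr₀.le this
    choose ψ hψc hψ0 hψ1 hψs hψz using fun m n => hC m (q n) (O n) (W n '' K) (hq n) (hO n) (hOM n)
      (hK.image_of_continuousOn ((hWd n).continuousOn.mono hKV))
      ((image_mono hKV).trans (hWO n).image_subset)
    set S : ℕ → Finset ℕ := fun m => (Finset.range k).filter (N m ≤ ·) with hSdef
    set l : ℂ → ℝ := fun z => 1 / Λ * (Real.log (‖z - a‖ ^ 2) - Real.log (ρ ^ 2)) with hl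
    set Ψ : ℂ → ℝ := fun z => ∑ m ∈ Finset.range k, ∑ n ∈ S m, ψ m n (W n z) with hΨ
    have hne_a : ∀ z ∈ V, z ≠ a := fun z hz h => haV (h ▸ hz)
    have hlc : ContinuousOn l K := by
      refine continuousOn_const.mul (ContinuousOn.sub (ContinuousOn.log (by fun_prop) ?_)
        continuousOn_const)
      intro z hz
      have := norm_pos_iff.2 (sub_ne_zero.2 (hne_a z (hKV hz)))
      positivity
    have hΨc : ContinuousOn Ψ K :=
      continuousOn_finsetSum _ fun m _ => continuousOn_finsetSum _ fun n _ =>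
        (hψc m n).comp_continuousOn ((hWd n).continuousOn.mono hKV)
    have hsuper : ∀ c ∈ interior K, LaplacianBoundAt (fun z => l z + Ψ z) c 0 := by
      intro c hc
      have hcK := interior_subset hc
      have h1 := (laplacianBoundAt_log a c (hne_a c (hKV hcK)) (Real.log (ρ ^ 2))).const_mul
        (one_div_pos.2 hΛ)
      have h2 : ∀ m ∈ Finset.range k, LaplacianBoundAt
          (fun z => ∑ n ∈ S m, ψ m n (W n z)) c (∑ n ∈ S m, 0) := fun m _ =>
        LaplacianBoundAt.sum _ fun n _ => (hψs m n _ (mem_image_of_mem _ hcK)).comp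
          (eventually_of_mem (hV.mem_nhds (hKV hcK)) fun z hz =>
            (hWd n).differentiableAt (hV.mem_nhds hz))
      exact (h1.add (LaplacianBoundAt.sum _ h2)).mono (by simp)
    have hlz₀ : l z₀ < 1 / 4 := by
      simp only [hl]
      rw [div_mul_eq_mul_div, div_lt_iff₀ hΛ]
      linarith
    have hΨz₀ : Ψ z₀ ≤ 1 / 2 := by
      have h1 : ∀ m ∈ Finset.range k, ∑ n ∈ S m, ψ m n (W n z₀) ≤ (1 / 2) ^ (m + 2) := by
        intro m _
        have h2 : ∀ n ∈ S m, N m ≤ n := fun n hn => (Finset.mem_filter.1 hn).2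
        exact (Finset.sum_le_sum fun n hn => hψz m n _ (hN₁ m n (h2 n hn))).trans (hN₂ m _ h2).le
      refine (Finset.sum_le_sum h1).trans ?_
      have h3 := sum_geometric_two_le k
      simp only [pow_add]
      rw [← Finset.sum_mul]
      linarith
    obtain ⟨c, hcK, hci, hc1⟩ := hK.exists_notMem_interior_lt_one (hlc.add hΨc) hsuper hz₀K
      (show l z₀ + Ψ z₀ < 1 by linarith)
    replace hc1 : l c + Ψ c < 1 := hc1
    have hcV := hKV hcK
    have hl0 : 0 ≤ l c := mul_nonneg (one_div_pos.2 hΛ).le (hlogρ c hcV)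
    have hterm : ∀ m n, 0 ≤ ψ m n (W n c) := fun m n => hψ0 m n _ (hWO n hcV)
    have hsum0 : ∀ m ∈ Finset.range k, 0 ≤ ∑ n ∈ S m, ψ m n (W n c) := fun m _ =>
      Finset.sum_nonneg fun n _ => hterm m n
    have hΨ0 : 0 ≤ Ψ c := Finset.sum_nonneg hsum0
    have hcL : ‖c - a‖ < L := by
      by_contra! hge
      have hLpos : 0 < L := (hρ.trans_le (ha z₀ hz₀)).trans_le hL1
      have h1 := Real.log_le_log (by positivity) (pow_le_pow_left₀ hLpos.le hge 2)
      have h2 : 1 ≤ l c := by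
        simp only [hl]
        rw [div_mul_eq_mul_div, le_div_iff₀ hΛ]
        linarith
      linarith
    refine ⟨c, hcV, hcL.le, ?_, fun m hm n hn hmn => ?_⟩
    · by_contra! hgt
      refine hci (mem_interior.2 ⟨{z | r k < Metric.infDist z Vᶜ} ∩ Metric.ball a L, ?_,
        (isOpen_lt continuous_const hdist).inter Metric.isOpen_ball, hgt,
        by simpa [dist_eq_norm] using hcL⟩)
      exact inter_subset_inter (fun z (hz : r k < _) => show r k ≤ _ from hz.le) Metric.ball_subset_closedBall
    · by_contra! hgt
      have h1 := hψ1 m n _ (hWO n hcV) hgt.le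
      have h2 : ψ m n (W n c) ≤ ∑ n ∈ S m, ψ m n (W n c) :=
        Finset.single_le_sum (f := fun n => ψ m n (W n c)) (fun n _ => hterm m n)
          (Finset.mem_filter.2 ⟨Finset.mem_range.2 hn, hmn⟩)
      have h3 : ∑ n ∈ S m, ψ m n (W n c) ≤ Ψ c :=
        Finset.single_le_sum (f := fun m => ∑ n ∈ S m, ψ m n (W n c)) hsum0
          (Finset.mem_range.2 hm)
      linarith
  choose c hcV hcL hcr hcW using hstep
  obtain ⟨z, -, φ, hφ, hz⟩ := (isCompact_closedBall a L).tendsto_subseq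
    (x := c) fun k => by simpa [dist_eq_norm] using hcL k
  have hdlim : Tendsto d atTop (𝓝 0) := tendsto_one_div_add_atTop_nhds_zero_nat
  have hzcl : z ∈ closure V := mem_closure_of_tendsto hz (Eventually.of_forall fun k => hcV _)
  have hzV : z ∉ V := by
    have h1 : Tendsto (fun k => Metric.infDist (c (φ k)) Vᶜ) atTop (𝓝 (Metric.infDist z Vᶜ)) :=
      ((Metric.continuous_infDist_pt _).tendsto z).comp hz
    have h2 : Tendsto (fun k => r (φ k)) atTop (𝓝 0) := by
      have := (hdlim.comp hφ.tendsto_atTop).const_mul r₀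
      simpa using this
    have h3 := le_of_tendsto_of_tendsto' h1 h2 fun k => hcr (φ k)
    intro h
    have := (hV.isClosed_compl.notMem_iff_infDist_pos hne).1 (by simpa using h : z ∉ Vᶜ)
    linarith
  refine ⟨z, ⟨hzcl, by rwa [hV.interior_eq]⟩, fun δ hδ => ?_⟩
  obtain ⟨m, hm⟩ := (hdlim.eventually (gt_mem_nhds hδ)).exists
  refine ⟨N m, fun n hn => ?_⟩
  have h1 : Tendsto (fun k => ‖W n (c (φ k)) - q n‖) atTop (𝓝 ‖W n z - q n‖) := by
    refine Tendsto.norm (Tendsto.sub_const ?_ _)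
    exact (hWc n z hzcl).tendsto.comp (tendsto_nhdsWithin_iff.2
      ⟨hz, Eventually.of_forall fun k => subset_closure (hcV _)⟩)
  have h2 : ‖W n z - q n‖ ≤ 2 * d m := by
    refine le_of_tendsto h1 ?_
    filter_upwards [eventually_gt_atTop (max m n)] with k hk
    have h3 := hφ.id_le k
    simp only [id] at h3
    exact hcW (φ k) m (by omega) n (by omega) hn
  linarith

theorem isOpen_fatouSet (f : ℂ → ℂ) : IsOpen (FatouSet f) := by
  refine isOpen_iff_mem_nhds.2 fun z ⟨_, U, hU, hzU, hU0, hUe⟩ => ?_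
  exact mem_of_superset (hU.mem_nhds hzU) fun w hw => ⟨hU0 w hw, U, hU, hw, hU0, hUe⟩

namespace IsFatouComponent

variable {f : ℂ → ℂ} {U U' : Set ℂ}

theorem isOpen (h : IsFatouComponent f U) : IsOpen U := by
  obtain ⟨z, -, rfl⟩ := h
  exact (isOpen_fatouSet f).connectedComponentIn

theorem nonempty (h : IsFatouComponent f U) : U.Nonempty := by
  obtain ⟨z, hz, rfl⟩ := h
  exact ⟨z, mem_connectedComponentIn hz⟩

theorem ne_zero (h : IsFatouComponent f U) {z : ℂ} (hz : z ∈ U) : z ≠ 0 := by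
  obtain ⟨z, -, rfl⟩ := h
  exact (connectedComponentIn_subset _ _ hz).1

theorem disjoint (h : IsFatouComponent f U) (h' : IsFatouComponent f U') (hne : U ≠ U') :
    Disjoint U U' := by
  obtain ⟨z, -, rfl⟩ := h
  obtain ⟨z', -, rfl⟩ := h'
  exact Set.disjoint_left.2 fun w hw hw' =>
    hne ((connectedComponentIn_eq hw).trans (connectedComponentIn_eq hw').symm)

end IsFatouComponent

/-- Let `f̃` be a transcendental entire lift of a transcendental self-map `f`
of `ℂ*` (i.e. `exp ∘ f̃ = f ∘ exp`), let `U ⊆ Ĩ_e(f)` be a wandering domain of `f`, and let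
`V` be a connected component of `exp⁻¹(U)`. Then some `z ∈ ∂V` satisfies: for every `R > 0`,
eventually `Re f̃ⁿ(z) > R` whenever `e_n = ∞` and `Re f̃ⁿ(z) < -R` whenever `e_n = 0`. -/
theorem lift_wandering_domain_boundary_point (f ft : ℂ → ℂ)
    (hft : IsTranscendentalEntire ft) (hf : IsTranscendentalSelfMapCStar f)
    (hlift : ∀ z : ℂ, Complex.exp (ft z) = f (Complex.exp z))
    (e : ℕ → Bool) (U : Set ℂ) (hU : IsWanderingDomain f U)
    (hUe : U ⊆ immediateLittleEscapingSet f e)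
    (V : Set ℂ) (z₀ : ℂ) (hz₀ : Complex.exp z₀ ∈ U)
    (hV : V = connectedComponentIn (Complex.exp ⁻¹' U) z₀) :
    ∃ z ∈ frontier V, ∀ R : ℝ, 0 < R → ∃ N : ℕ, ∀ n ≥ N,
      (e n = true → R < (ft^[n] z).re) ∧ (e n = false → (ft^[n] z).re < -R) := by
  obtain ⟨hUF, D, hD0, hDF, hDf, hDinj⟩ := hU
  have hUo := hUF.isOpen
  set a := exp z₀ with ha
  have ha0 : a ≠ 0 := exp_ne_zero _
  have hna : 0 < ‖a‖ := norm_pos_iff.2 ha0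
  obtain ⟨ρ, hρ, hρU⟩ := Metric.isOpen_iff.1 hUo a hz₀
  have hfar : ∀ w ∉ U, ρ ≤ ‖w - a‖ := fun w hw => by
    by_contra! h
    exact hw (hρU (by rwa [Metric.mem_ball, dist_eq_norm]))
  have hVo : IsOpen V := hV ▸ (hUo.preimage continuous_exp).connectedComponentIn
  have hz₀V : z₀ ∈ V := hV ▸ mem_connectedComponentIn hz₀
  have hVU : ∀ z ∈ V, exp z ∈ U := fun z hz => by
    rw [hV] at hz
    exact (connectedComponentIn_subset (Complex.exp ⁻¹' U) z₀ hz : z ∈ Complex.exp ⁻¹' U)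
  have hftd : ∀ n, Differentiable ℂ (ft^[n]) := fun n => hft.1.iterate n
  have hiter : ∀ n z, exp (ft^[n] z) = f^[n] (exp z) := fun n z =>
    (Function.Semiconj.iterate_right (f := exp) (ga := ft) (gb := f) hlift n) z
  have hDiter : ∀ n, ∀ w ∈ U, f^[n] w ∈ D n := by
    intro n w hw
    induction n with
    | zero => simpa [hD0] using hw
    | succ n ih =>
      rw [Function.iterate_succ_apply']
      exact hDf n (mem_image_of_mem f ih)
  have hDdisj : ∀ m n, m ≠ n → Disjoint (D m) (D n) := fun m n hmn =>
    (hDF m).disjoint (hDF n) fun h => hmn (hDinj h)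
  have hDU : ∀ n, Disjoint (D (n + 1)) U := fun n => hD0 ▸ hDdisj (n + 1) 0 (by omega)
  have hgD : ∀ n, ∀ z ∈ V, exp (ft^[n + 1] z) ∈ D (n + 1) := fun n z hz => by
    rw [hiter]
    exact hDiter _ _ (hVU z hz)
  have hgcl : ∀ n, ∀ z ∈ closure V, exp (ft^[n + 1] z) ∉ U := by
    intro n
    have hcl : IsClosed ((fun z => exp (ft^[n + 1] z)) ⁻¹' Uᶜ) :=
      hUo.isClosed_compl.preimage (continuous_exp.comp (hftd _).continuous)
    exact closure_minimal (fun z hz => Set.disjoint_left.1 (hDU n) (hgD n z hz)) hcl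
  have hgne : ∀ n, ∀ z ∈ closure V, exp (ft^[n + 1] z) - a ≠ 0 := fun n z hz =>
    norm_pos_iff.1 (hρ.trans_le (hfar _ (hgcl n z hz)))
  obtain ⟨a', ρ', hρ', hVa'⟩ : ∃ (a' : ℂ) (ρ' : ℝ), 0 < ρ' ∧ ∀ z ∈ V, ρ' ≤ ‖z - a'‖ := by
    obtain ⟨w, hw⟩ := (hDF 1).nonempty
    have hlog : exp (log w) ∈ D 1 := by rwa [exp_log ((hDF 1).ne_zero hw)]
    obtain ⟨r, hr, hsub⟩ := Metric.isOpen_iff.1 ((hDF 1).isOpen.preimage continuous_exp) _ hlog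
    refine ⟨log w, r, hr, fun z hz => ?_⟩
    by_contra! h
    have hz1 : exp z ∈ D 1 := hsub (by rwa [Metric.mem_ball, dist_eq_norm])
    exact Set.disjoint_left.1 (hDU 0) hz1 (hVU z hz)
  set M := max (1 / ρ) ‖a⁻¹‖ with hM
  set q : ℕ → ℂ := fun n => if e (n + 1) = true then 0 else -a⁻¹ with hq
  set O : ℕ → Set ℂ := fun n => {ζ | ζ ≠ 0 ∧ ζ⁻¹ + a ∈ D (n + 1)} with hOdef
  have hshift : ∀ w, w - a ≠ 0 → (w - a)⁻¹ + a⁻¹ = w * (a⁻¹ * (w - a)⁻¹) := fun w hw => by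
    field_simp; ring
  obtain ⟨c, hc, hcW⟩ := exists_frontier_forall_norm_sub_le hVo hz₀V hρ' hVa'
    (M := M) (lt_max_of_lt_left (one_div_pos.2 hρ))
    (W := fun n z => (exp (ft^[n + 1] z) - a)⁻¹) (O := O) (q := q)
    (fun n z hz => by
      have := hgne n z (subset_closure hz)
      exact (((hftd (n + 1)).cexp z).sub_const a |>.inv this).differentiableWithinAt)
    (fun n => ContinuousOn.inv₀
      (((continuous_exp.comp (hftd (n + 1)).continuous).sub continuous_const).continuousOn)
      (hgne n))
    (fun n => by
      have hinv : ContinuousOn (fun ζ : ℂ => ζ⁻¹ + a) {ζ | ζ ≠ 0} :=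
        (continuousOn_inv₀.mono fun _ h => h).add continuousOn_const
      exact hinv.isOpen_inter_preimage isOpen_ne (hDF (n + 1)).isOpen)
    (fun m n hmn => Set.disjoint_left.2 fun ζ h1 h2 =>
      Set.disjoint_left.1 (hDdisj (m + 1) (n + 1) (by omega)) h1.2 h2.2)
    (fun n ζ hζ => by
      have h1 := hfar _ (Set.disjoint_left.1 (hDU n) hζ.2)
      rw [add_sub_cancel_right, norm_inv] at h1
      rw [mem_closedBall_zero_iff]
      refine le_max_of_le_left ?_
      rw [one_div]
      exact (le_inv_comm₀ hρ (norm_pos_iff.2 hζ.1)).1 h1)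
    (fun n z hz => by
      refine ⟨inv_ne_zero (hgne n z (subset_closure hz)), ?_⟩
      rw [inv_inv, sub_add_cancel]
      exact hgD n z hz)
    (fun n => by
      simp only [hq]
      split_ifs
      · simp only [norm_zero]
        exact le_max_of_le_left (by positivity)
      · rw [norm_neg]
        exact le_max_right _ _)
    (by
      obtain ⟨⟨-, hesc⟩, ℓ, hℓ⟩ := hUe hz₀
      rw [Metric.tendsto_atTop]
      intro ε hε
      obtain ⟨ε', hε', h1, h2, h3⟩ : ∃ ε' : ℝ, 0 < ε' ∧ ε' ≤ 1 ∧ ε' * (ε⁻¹ + ‖a‖) ≤ 1 ∧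
          ε' ≤ ε * (‖a‖ * ρ) := by
        have hp : 0 < ε⁻¹ + ‖a‖ := by positivity
        refine ⟨min 1 (min (ε⁻¹ + ‖a‖)⁻¹ (ε * (‖a‖ * ρ))), by positivity, min_le_left _ _, ?_,
          (min_le_right _ _).trans (min_le_right _ _)⟩
        rw [← le_div_iff₀ hp, one_div]
        exact (min_le_right _ _).trans (min_le_left _ _)
      obtain ⟨N, hN⟩ := hesc ε' hε'
      have hinv : 1 ≤ 1 / ε' := by rwa [le_div_iff₀ hε', one_mul]
      refine ⟨max N ℓ, fun n hn => ?_⟩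
      have hn1 : N ≤ n := le_of_max_le_left hn
      have hn2 : ℓ ≤ n := le_of_max_le_right hn
      have hesc' := hN (n + 1) (by omega)
      have hsign := hℓ (n + 1 - ℓ)
      rw [Nat.sub_add_cancel (by omega)] at hsign
      rw [Real.dist_eq, sub_zero, abs_norm]
      have hzc := subset_closure (s := V) hz₀V
      have hne := hgne n z₀ hzc
      have hfar' := hfar _ (hgcl n z₀ hzc)
      rw [hiter] at hne hfar' ⊢
      set w := f^[n + 1] (exp z₀)
      by_cases he : e (n + 1) = true
      · have hw1 : 1 < ‖w‖ := hsign.2 he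
        have hw2 : 1 / ε' < ‖w‖ := hesc'.resolve_left (by linarith)
        have hw3 : ε⁻¹ + ‖a‖ ≤ 1 / ε' := by
          rw [le_div_iff₀ hε']; linarith
        have hw4 := norm_sub_norm_le w a
        simp only [hq, he, if_true, sub_zero]
        rw [norm_inv]
        exact inv_lt_of_inv_lt₀ hε (by linarith)
      · have hw1 : ‖w‖ ≤ 1 := not_lt.1 fun h => he (hsign.1 h)
        have hw2 : ‖w‖ < ε' := hesc'.resolve_right (by linarith)
        simp only [hq, he, Bool.false_eq_true, if_false, sub_neg_eq_add]
        rw [hshift w hne, norm_mul, norm_mul, norm_inv, norm_inv, ← mul_inv, ← div_eq_mul_inv,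
          div_lt_iff₀ (by positivity)]
        calc ‖w‖ < ε * (‖a‖ * ρ) := by linarith
          _ ≤ _ := by gcongr)
  refine ⟨c, hc, fun R hR => ?_⟩
  have hB : 0 < ‖a‖ + Real.exp R + 1 := by positivity
  obtain ⟨N₁, hN₁⟩ := hcW (1 / (2 * (‖a‖ + Real.exp R + 1))) (by positivity)
  obtain ⟨N₂, hN₂⟩ := hcW (min (1 / (4 * ‖a‖)) (Real.exp (-R) / (8 * ‖a‖ ^ 2))) (by positivity)
  refine ⟨max N₁ N₂ + 1, fun n hn => ?_⟩
  obtain ⟨n, rfl⟩ : ∃ k, n = k + 1 := ⟨n - 1, by omega⟩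
  have hn' : max N₁ N₂ ≤ n := by omega
  have h1 := hN₁ n (le_of_max_le_left hn')
  have h2 := hN₂ n (le_of_max_le_right hn')
  beta_reduce at h1 h2
  have hne := hgne n c hc.1
  have hnorm := norm_exp (ft^[n + 1] c)
  set w := exp (ft^[n + 1] c)
  have hwa := norm_pos_iff.2 hne
  refine ⟨fun he => ?_, fun he => ?_⟩
  · simp only [hq, he, if_true, sub_zero] at h1
    rw [norm_inv, show 2 * (1 / (2 * (‖a‖ + Real.exp R + 1))) = (‖a‖ + Real.exp R + 1)⁻¹ by
      field_simp, inv_le_inv₀ hwa hB] at h1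
    have h3 := norm_sub_le w a
    rw [← Real.exp_lt_exp, ← hnorm]
    linarith
  · simp only [hq, he, Bool.false_eq_true, if_false, sub_neg_eq_add] at h2
    set δ := min (1 / (4 * ‖a‖)) (Real.exp (-R) / (8 * ‖a‖ ^ 2)) with hδ
    have hδ1 : δ * (4 * ‖a‖) ≤ 1 := by
      rw [← le_div_iff₀ (by positivity)]; exact min_le_left _ _
    have hδ2 : δ * (8 * ‖a‖ ^ 2) ≤ Real.exp (-R) := by
      rw [← le_div_iff₀ (by positivity)]; exact min_le_right _ _
    have hδ0 : 0 < δ := by positivity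
    rw [hshift w hne, norm_mul, norm_mul, norm_inv, norm_inv, ← mul_inv, ← div_eq_mul_inv,
      div_le_iff₀ (by positivity)] at h2
    have h3 := norm_sub_le w a
    have h4 : ‖w‖ ≤ 2 * δ * (‖a‖ * (‖w‖ + ‖a‖)) := h2.trans (by gcongr)
    have h5 : ‖w‖ ≤ δ * (4 * ‖a‖ ^ 2) := by
      nlinarith [mul_le_mul_of_nonneg_right hδ1 (norm_nonneg w)]
    have h6 : 0 < δ * (4 * ‖a‖ ^ 2) := by positivity
    rw [← Real.exp_lt_exp, ← hnorm]
    linarith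
end
end

section
/- Let f be a transcendental self-map of ℂ*, and suppose that E ⊆ ℂ* is completely invariant under f and satisfies J(f) = cl(E ∩ J(f)), where cl denotes closure in ℂ*. If E is not connected, then E has infinitely many connected components. -/
open Complex Topology Filter Set Function OnePoint

noncomputable section

section HalfPlane

open Metric

theorem norm_sub_le_norm_add_conj {W G : ℂ} (hW : 0 < W.re) (hG : 0 < G.re) :
    ‖W - G‖ ≤ ‖W + starRingEnd ℂ G‖ := by
  rw [← sq_le_sq₀ (norm_nonneg _) (norm_nonneg _), Complex.sq_norm, Complex.sq_norm,
    Complex.normSq_apply, Complex.normSq_apply]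
  simp only [sub_re, sub_im, add_re, add_im, conj_re, conj_im]
  nlinarith [mul_pos hW hG]

theorem re_lower_bound_of_norm_sub_le {W G : ℂ} {ρ : ℝ} (hG : 0 < G.re)
    (hW : 0 < W.re) (hρ : 0 ≤ ρ) (hρ1 : ρ < 1)
    (h : ‖W - G‖ ≤ ρ * ‖W + starRingEnd ℂ G‖) : (1 - ρ) * G.re / 4 ≤ W.re := by
  have h2 : ‖W - G‖ ^ 2 ≤ ρ ^ 2 * ‖W + starRingEnd ℂ G‖ ^ 2 := by
    rw [← mul_pow]
    gcongr
  rw [Complex.sq_norm, Complex.sq_norm, Complex.normSq_apply, Complex.normSq_apply] at h2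
  simp only [sub_re, sub_im, add_re, add_im, conj_re, conj_im] at h2
  have hρ2 : 1 - ρ ≤ 1 - ρ ^ 2 := by nlinarith
  have h3 : (1 - ρ ^ 2) * G.re ^ 2 ≤ 4 * W.re * G.re := by
    have : 0 ≤ 1 - ρ ^ 2 := by nlinarith
    nlinarith [mul_nonneg this (sq_nonneg (W.im - G.im)),
      mul_nonneg this (sq_nonneg W.re), mul_nonneg this (mul_pos hW hG).le]
  have h4 : (1 - ρ ^ 2) * G.re ≤ 4 * W.re := by
    have : ((1 - ρ ^ 2) * G.re) * G.re ≤ (4 * W.re) * G.re := by nlinarith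
    exact le_of_mul_le_mul_right this hG
  nlinarith

/-- Schwarz's lemma for holomorphic functions from a disc to the right half-plane: a bound for
the derivative at the centre and a Harnack-type lower bound. -/
theorem schwarz_rightHalfPlane {g : ℂ → ℂ} {c : ℂ} {d : ℝ} (hd : 0 < d)
    (hg : DifferentiableOn ℂ g (ball c d)) (hpos : ∀ z ∈ ball c d, 0 < (g z).re) :
    ‖deriv g c‖ ≤ 2 * (g c).re / d ∧
      ∀ z ∈ ball c d, (1 - dist z c / d) * (g c).re / 4 ≤ (g z).re := by
  have hc : c ∈ ball c d := mem_ball_self hd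
  have hgc := hpos c hc
  have hne : ∀ z ∈ ball c d, g z + starRingEnd ℂ (g c) ≠ 0 := by
    intro z hz h0
    have := congrArg Complex.re h0
    simp only [add_re, conj_re, zero_re] at this
    linarith [hpos z hz]
  set φ : ℂ → ℂ := fun z => (g z - g c) / (g z + starRingEnd ℂ (g c)) with hφ
  have hφd : DifferentiableOn ℂ φ (ball c d) :=
    (hg.sub_const _).div (hg.add_const _) hne
  have hφc : φ c = 0 := by simp [hφ]
  have hmaps : MapsTo φ (ball c d) (closedBall (φ c) 1) := by
    intro z hz
    rw [hφc, mem_closedBall_zero_iff, hφ, norm_div]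
    exact div_le_one_of_le₀ (norm_sub_le_norm_add_conj (hpos z hz) hgc) (norm_nonneg _)
  constructor
  · have h1 := Complex.norm_deriv_le_div_of_mapsTo_ball hφd hmaps hd
    have hgd : HasDerivAt g (deriv g c) c :=
      (hg.differentiableAt (isOpen_ball.mem_nhds hc)).hasDerivAt
    have h2 : HasDerivAt φ (deriv g c / (g c + starRingEnd ℂ (g c))) c := by
      have := (hgd.sub_const (g c)).fun_div (hgd.add_const (starRingEnd ℂ (g c))) (hne c hc)
      refine this.congr_deriv ?_
      rw [sub_self, zero_mul, sub_zero, pow_two, mul_div_mul_right _ _ (hne c hc)]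
    rw [h2.deriv, norm_div, Complex.add_conj, Complex.norm_real, Real.norm_of_nonneg (by linarith),
      div_le_div_iff₀ (by linarith) hd] at h1
    rw [le_div_iff₀ hd]
    linarith
  · intro z hz
    have h1 := Complex.dist_le_div_mul_dist_of_mapsTo_ball hφd hmaps hz
    rw [hφc, dist_zero_right, hφ, norm_div,
      div_le_iff₀ (norm_pos_iff.mpr (hne z hz))] at h1
    refine re_lower_bound_of_norm_sub_le hgc (hpos z hz) (by positivity)
      ((div_lt_one hd).mpr hz) (h1.trans_eq ?_)
    ring

theorem re_pos_or_re_neg_pos_of_re_ne_zero {g : ℂ → ℂ} {c : ℂ} {d : ℝ}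
    (hg : DifferentiableOn ℂ g (ball c d)) (hne : ∀ z ∈ ball c d, (g z).re ≠ 0) :
    (∀ z ∈ ball c d, 0 < (g z).re) ∨ ∀ z ∈ ball c d, 0 < (-g z).re := by
  have hcont : ContinuousOn (fun z => (g z).re) (ball c d) :=
    Complex.continuous_re.comp_continuousOn hg.continuousOn
  have hpre : IsPreconnected (ball c d) := (convex_ball c d).isPreconnected
  by_contra! h
  obtain ⟨⟨z, hz, hz0⟩, w, hw, hw0⟩ := h
  simp only [neg_re, Left.neg_nonpos_iff] at hw0
  obtain ⟨x, hx, hx0⟩ := hpre.intermediate_value hz hw hcont ⟨hz0, hw0⟩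
  exact hne x hx hx0

theorem norm_deriv_le_of_re_ne_zero {g : ℂ → ℂ} {c : ℂ} {d : ℝ} (hd : 0 < d)
    (hg : DifferentiableOn ℂ g (ball c d)) (hne : ∀ z ∈ ball c d, (g z).re ≠ 0) :
    ‖deriv g c‖ ≤ 2 * |(g c).re| / d := by
  rcases re_pos_or_re_neg_pos_of_re_ne_zero hg hne with h | h
  · rw [abs_of_pos (h c (mem_ball_self hd))]
    exact (schwarz_rightHalfPlane hd hg h).1
  · have := (schwarz_rightHalfPlane hd hg.neg h).1
    have hc := h c (mem_ball_self hd)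
    simp only [neg_re, Pi.neg_apply] at hc this
    rw [abs_of_neg (by linarith)]
    simpa [deriv.fun_neg, deriv.neg] using this

theorem norm_deriv_le_norm_deriv_boundary_of_re_pos {g : ℂ → ℂ} {c p : ℂ} {d : ℝ} (hd : 0 < d)
    (hg : DifferentiableOn ℂ g (ball c d)) (hpos : ∀ z ∈ ball c d, 0 < (g z).re)
    (hp : dist p c = d) (hgp : DifferentiableAt ℂ g p) (hp0 : (g p).re = 0) :
    ‖deriv g c‖ ≤ 8 * ‖deriv g p‖ := by
  obtain ⟨h1, h2⟩ := schwarz_rightHalfPlane hd hg hpos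
  set x := (g c).re with hx
  have hx0 : 0 < x := hpos c (mem_ball_self hd)
  suffices h : x / (4 * d) ≤ ‖deriv g p‖ by
    refine h1.trans ?_
    have : 2 * x / d = 8 * (x / (4 * d)) := by field_simp; norm_num
    rw [this]
    linarith
  by_contra! hlt
  obtain ⟨K, hK1, hK2⟩ := exists_between hlt
  have hev : ∀ᶠ z in 𝓝 p, ‖g z - g p‖ ≤ K * ‖z - p‖ := by
    have h := hgp.hasDerivAt.isLittleO.bound (sub_pos.mpr hK1)
    filter_upwards [h] with z hz
    calc ‖g z - g p‖ = ‖(g z - g p - (z - p) • deriv g p) + (z - p) • deriv g p‖ := by ring_nf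
      _ ≤ (K - ‖deriv g p‖) * ‖z - p‖ + ‖(z - p) • deriv g p‖ :=
        (norm_add_le _ _).trans (by gcongr)
      _ = K * ‖z - p‖ := by rw [norm_smul]; ring
  have htend : Tendsto (fun t : ℝ => p + (t : ℂ) * (c - p)) (𝓝[>] 0) (𝓝 p) := by
    have : Continuous (fun t : ℝ => p + (t : ℂ) * (c - p)) := by fun_prop
    have h := this.tendsto 0
    simp only [ofReal_zero, zero_mul, add_zero] at h
    exact h.mono_left nhdsWithin_le_nhds
  have hev2 : ∀ᶠ t : ℝ in 𝓝[>] 0, t ∈ Ioo (0 : ℝ) 1 := Ioo_mem_nhdsGT one_pos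
  obtain ⟨t, ht, ht0, ht1⟩ := ((htend.eventually hev).and hev2).exists
  have hcp : ‖c - p‖ = d := by rw [← dist_eq_norm, dist_comm, hp]
  have hdist : dist (p + (t : ℂ) * (c - p)) c = (1 - t) * d := by
    rw [dist_eq_norm, show p + (t : ℂ) * (c - p) - c = -(((1 - t : ℝ) : ℂ) * (c - p)) by
      push_cast; ring, norm_neg, norm_mul, hcp, Complex.norm_real,
      Real.norm_of_nonneg (by linarith)]
  have h3 := h2 (p + (t : ℂ) * (c - p)) (by rw [mem_ball, hdist]; nlinarith)
  rw [hdist, mul_div_cancel_right₀ _ hd.ne'] at h3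
  have h4 : (g (p + (t : ℂ) * (c - p))).re ≤ K * (t * d) := by
    calc _ = (g (p + (t : ℂ) * (c - p)) - g p).re := by rw [sub_re, hp0, sub_zero]
      _ ≤ ‖g (p + (t : ℂ) * (c - p)) - g p‖ := Complex.re_le_norm _
      _ ≤ _ := ht
      _ = K * (t * d) := by
        rw [add_sub_cancel_left, norm_mul, hcp, Complex.norm_real, Real.norm_of_nonneg ht0.le]
  rw [lt_div_iff₀ (by positivity)] at hK2
  nlinarith

/-- If `U` is holomorphic near a closed disc about `s` and `Re U` vanishes at a point of its
boundary circle, then `|U' s|` is controlled by `|U'|` at a zero of `Re U` nearest to `s`. -/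
theorem exists_re_eq_zero_norm_deriv_le {U : ℂ → ℂ} {s s₁ : ℂ}
    (hU : ∀ z ∈ closedBall s (dist s₁ s), DifferentiableAt ℂ U z) (h₁ : (U s₁).re = 0) :
    ∃ p, (U p).re = 0 ∧ dist p s ≤ dist s₁ s ∧ ‖deriv U s‖ ≤ 8 * ‖deriv U p‖ := by
  have hcont : ContinuousOn (fun z => (U z).re) (closedBall s (dist s₁ s)) := fun z hz =>
    (Complex.continuous_re.continuousAt.comp (hU z hz).continuousAt).continuousWithinAt
  have hK : IsCompact (closedBall s (dist s₁ s) ∩ (fun z => (U z).re) ⁻¹' {0}) :=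
    (isCompact_closedBall s _).of_isClosed_subset
      (hcont.preimage_isClosed_of_isClosed isClosed_closedBall isClosed_singleton)
      inter_subset_left
  obtain ⟨p, ⟨hp1, hp2⟩, hmin⟩ := hK.exists_isMinOn ⟨s₁, mem_closedBall.mpr le_rfl, h₁⟩
    (continuous_id.dist continuous_const : Continuous fun z => dist z s).continuousOn
  refine ⟨p, hp2, hp1, ?_⟩
  rcases eq_or_ne p s with rfl | hps
  · linarith [norm_nonneg (deriv U p)]
  · have hd : 0 < dist p s := dist_pos.mpr hps
    have hsub : ball s (dist p s) ⊆ closedBall s (dist s₁ s) :=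
      ball_subset_closedBall.trans (closedBall_subset_closedBall hp1)
    have hdiff : DifferentiableOn ℂ U (ball s (dist p s)) := fun z hz =>
      (hU z (hsub hz)).differentiableWithinAt
    have hne : ∀ z ∈ ball s (dist p s), (U z).re ≠ 0 := fun z hz h0 =>
      absurd (isMinOn_iff.mp hmin z ⟨hsub hz, h0⟩) (not_le.mpr hz)
    rcases re_pos_or_re_neg_pos_of_re_ne_zero hdiff hne with h | h
    · exact norm_deriv_le_norm_deriv_boundary_of_re_pos hd hdiff h rfl (hU p hp1) hp2
    · have := norm_deriv_le_norm_deriv_boundary_of_re_pos hd hdiff.neg h rfl (hU p hp1).neg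
        (by simpa using hp2)
      simpa [deriv.neg] using this

end HalfPlane

section Landau

open Metric

theorem exists_int_norm_sub_le_pi (w : ℂ) (hw : w.re = 0) :
    ∃ k : ℤ, ‖(k : ℂ) * (2 * Real.pi * I) - w‖ ≤ Real.pi := by
  refine ⟨round (w.im / (2 * Real.pi)), ?_⟩
  have hπ := Real.pi_pos
  have hw' : w = (w.im : ℂ) * I := by
    apply Complex.ext <;> simp [hw]
  have h : ((round (w.im / (2 * Real.pi)) : ℤ) : ℂ) * (2 * Real.pi * I) - w =
      ((2 * Real.pi * (round (w.im / (2 * Real.pi)) - w.im / (2 * Real.pi)) : ℝ) : ℂ) * I := by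
    nth_rewrite 2 [hw']
    push_cast
    have : (Real.pi : ℂ) ≠ 0 := by exact_mod_cast hπ.ne'
    field_simp
  rw [h, norm_mul, Complex.norm_I, mul_one, Complex.norm_real, Real.norm_eq_abs, abs_mul,
    abs_of_pos (by positivity : 0 < 2 * Real.pi), abs_sub_comm]
  have := abs_sub_round (w.im / (2 * Real.pi))
  nlinarith

theorem norm_deriv_sub_le {V : ℂ → ℂ} {s : ℂ} {δ B : ℝ} (hδ : 0 < δ)
    (hV : ∀ z ∈ ball s δ, DifferentiableAt ℂ V z) (hB : ∀ z ∈ ball s δ, ‖deriv V z‖ ≤ B)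
    {z : ℂ} (hz : z ∈ ball s δ) : ‖deriv V z - deriv V s‖ ≤ 2 * B / δ * dist z s := by
  have hd : DifferentiableOn ℂ (deriv V) (ball s δ) :=
    DifferentiableOn.deriv (fun z hz => (hV z hz).differentiableWithinAt) isOpen_ball
  have hmaps : MapsTo (deriv V) (ball s δ) (closedBall (deriv V s) (2 * B)) := fun w hw => by
    rw [mem_closedBall, dist_eq_norm]
    linarith [norm_sub_le (deriv V w) (deriv V s), hB w hw, hB s (mem_ball_self hδ)]
  rw [← dist_eq_norm]
  exact Complex.dist_le_div_mul_dist_of_mapsTo_ball hd hmaps hz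

/-- If on a disc the derivative of a holomorphic function is bounded by a multiple of its size at
the centre, then the function takes every value near its central value at a point of the disc
where the derivative is still large. -/
theorem exists_eq_of_norm_deriv_le {U : ℂ → ℂ} {s v : ℂ} {δ A : ℝ} (hA : 0 < A) (hδ : 0 < δ)
    (hU : ∀ z ∈ ball s δ, DifferentiableAt ℂ U z) (hB : ∀ z ∈ ball s δ, ‖deriv U z‖ ≤ 16 * A)
    (hs : ‖deriv U s‖ = A) (hv : ‖v - U s‖ < A * δ / 256) :
    ∃ z ∈ ball s δ, U z = v ∧ A / 2 ≤ ‖deriv U z‖ := by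
  have hρ : 0 < δ / 64 := by positivity
  have hsub : closedBall s (δ / 64) ⊆ ball s δ := closedBall_subset_ball (by linarith)
  have hdev : ∀ z ∈ closedBall s (δ / 64), ‖deriv U z - deriv U s‖ ≤ A / 2 := fun z hz => by
    refine (norm_deriv_sub_le hδ hU hB (hsub hz)).trans ?_
    have hz' : dist z s ≤ δ / 64 := hz
    calc 2 * (16 * A) / δ * dist z s ≤ 2 * (16 * A) / δ * (δ / 64) := by gcongr
      _ = A / 2 := by field_simp; norm_num
  have hlin : ∀ z ∈ closedBall s (δ / 64),
      ‖(U z - deriv U s * z) - (U s - deriv U s * s)‖ ≤ A / 2 * ‖z - s‖ := by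
    intro z hz
    refine Convex.norm_image_sub_le_of_norm_hasDerivWithin_le
      (f := fun z => U z - deriv U s * z) (f' := fun z => deriv U z - deriv U s)
      (fun w hw => ?_) hdev (convex_closedBall s (δ / 64))
      (mem_closedBall_self hρ.le) hz
    have h1 := (hU w (hsub hw)).hasDerivAt.sub ((hasDerivAt_id w).const_mul (deriv U s))
    rw [mul_one] at h1
    exact h1.hasDerivWithinAt
  have hdcl : DiffContOnCl ℂ U (ball s (δ / 64)) := by
    refine DifferentiableOn.diffContOnCl fun z hz => ?_
    rw [closure_ball _ hρ.ne'] at hz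
    exact (hU z (hsub hz)).differentiableWithinAt
  have hsphere : ∀ z ∈ sphere s (δ / 64), A * δ / 128 ≤ ‖U z - U s‖ := fun z hz => by
    have h1 := hlin z (sphere_subset_closedBall hz)
    rw [mem_sphere_iff_norm] at hz
    rw [hz] at h1
    have h2 : ‖deriv U s * (z - s)‖ = A * (δ / 64) := by rw [norm_mul, hs, hz]
    have h3 : deriv U s * (z - s) =
      (U z - U s) - ((U z - deriv U s * z) - (U s - deriv U s * s)) := by ring
    have h4 := norm_sub_le (U z - U s) ((U z - deriv U s * z) - (U s - deriv U s * s))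
    rw [← h3, h2] at h4
    linarith
  have hfreq : ∃ᶠ z in 𝓝 s, U z ≠ U s := by
    have h0 : deriv U s ≠ 0 := norm_pos_iff.mp (hs ▸ hA)
    have h1 := (hU s (mem_ball_self hδ)).hasDerivAt.eventually_ne (c := U s) h0
    exact h1.frequently.filter_mono nhdsWithin_le_nhds
  obtain ⟨z, hz, hzv⟩ := hdcl.ball_subset_image_closedBall hρ hsphere hfreq
    (show v ∈ ball (U s) (A * δ / 128 / 2) by rw [mem_ball, dist_eq_norm]; linarith)
  refine ⟨z, hsub hz, hzv, ?_⟩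
  have h1 := hdev z hz
  have h2 := norm_sub_norm_le (deriv U s) (deriv U z)
  rw [norm_sub_rev, hs] at h2
  linarith

/-- A Landau-type estimate: if `|U'| ≤ M` wherever `exp U = 1` on a closed disc and
`|exp U| = 1` at its centre, then `|U'|` is bounded at the centre. -/
theorem norm_deriv_le_of_norm_deriv_le_at_period {U : ℂ → ℂ} {s₀ : ℂ} {R M : ℝ} (hR : 0 < R)
    (hUa : ∀ z ∈ closedBall s₀ R, AnalyticAt ℂ U z)
    (hM : ∀ z ∈ closedBall s₀ R, ∀ k : ℤ, U z = k * (2 * Real.pi * I) → ‖deriv U z‖ ≤ M)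
    (h₀ : (U s₀).re = 0) : R * ‖deriv U s₀‖ ≤ max 4096 (2 * M * R) := by
  have hU : ∀ z ∈ closedBall s₀ R, DifferentiableAt ℂ U z := fun z hz =>
    (hUa z hz).differentiableAt
  have hcont : ContinuousOn (fun z => (U z).re) (closedBall s₀ R) := fun z hz =>
    (Complex.continuous_re.continuousAt.comp (hU z hz).continuousAt).continuousWithinAt
  have hcont' : ContinuousOn (deriv U) (closedBall s₀ R) := fun z hz =>
    (hUa z hz).deriv.continuousAt.continuousWithinAt
  have hK : IsCompact (closedBall s₀ R ∩ (fun z => (U z).re) ⁻¹' {0}) :=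
    (isCompact_closedBall s₀ _).of_isClosed_subset
      (hcont.preimage_isClosed_of_isClosed isClosed_closedBall isClosed_singleton)
      inter_subset_left
  obtain ⟨s₁, ⟨hs1, hs10⟩, hmax⟩ := hK.exists_isMaxOn ⟨s₀, mem_closedBall_self hR.le, h₀⟩
    (f := fun z => (R - dist z s₀) * ‖deriv U z‖)
    ((ContinuousOn.mul (by fun_prop) hcont'.norm).mono inter_subset_left)
  rw [isMaxOn_iff] at hmax
  have h01 := hmax s₀ ⟨mem_closedBall_self hR.le, h₀⟩
  simp only [dist_self, sub_zero] at h01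
  refine h01.trans ?_
  by_contra! hlt
  obtain ⟨hlt1, hlt2⟩ := max_lt_iff.mp hlt
  set A := ‖deriv U s₁‖ with hA
  set δ := R - dist s₁ s₀ with hδ
  have hδ0 : 0 ≤ δ := sub_nonneg.mpr hs1
  have hA0 : 0 ≤ A := norm_nonneg _
  have hδpos : 0 < δ := by
    rcases hδ0.eq_or_lt with h | h
    · rw [← h] at hlt1; linarith
    · exact h
  have hApos : 0 < A := by
    rcases hA0.eq_or_lt with h | h
    · rw [← h] at hlt1; linarith
    · exact h
  have hδR : δ ≤ R := by rw [hδ]; linarith [dist_nonneg (x := s₁) (y := s₀)]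
  have hsub : ∀ z, dist z s₁ ≤ δ → z ∈ closedBall s₀ R := fun z hz => by
    rw [mem_closedBall]; linarith [dist_triangle z s₁ s₀]
  have hbound : ∀ z ∈ ball s₁ (δ / 4), ‖deriv U z‖ ≤ 16 * A := fun z hz => by
    rw [mem_ball] at hz
    obtain ⟨p, hp0, hp1, hp2⟩ := exists_re_eq_zero_norm_deriv_le (U := U) (s := z) (s₁ := s₁)
      (fun w hw => hU w (hsub w (by
        rw [mem_closedBall, dist_comm s₁] at hw
        linarith [dist_triangle w z s₁]))) hs10
    have hp3 : dist p s₁ < δ / 2 := by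
      rw [dist_comm s₁] at hp1
      linarith [dist_triangle p z s₁]
    have hp4 := hmax p ⟨hsub p (by linarith), hp0⟩
    have hp5 : δ / 2 ≤ R - dist p s₀ := by
      linarith [dist_triangle p s₁ s₀]
    have hp6 : δ / 2 * ‖deriv U p‖ ≤ δ * A := le_trans (by gcongr) hp4
    have hp7 : ‖deriv U p‖ ≤ 2 * A := by
      have : δ * ‖deriv U p‖ ≤ δ * (2 * A) := by linarith
      exact le_of_mul_le_mul_left this hδpos
    linarith
  obtain ⟨k, hk⟩ := exists_int_norm_sub_le_pi (U s₁) hs10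
  obtain ⟨z, hz, hz1, hz2⟩ := exists_eq_of_norm_deriv_le hApos (by positivity : 0 < δ / 4)
    (fun z hz => hU z (hsub z (by rw [mem_ball] at hz; linarith))) hbound rfl
    (hk.trans_lt (by linarith [Real.pi_lt_d2]))
  have h1 := hM z (hsub z (by rw [mem_ball] at hz; linarith)) k hz1
  have h2 : δ * A ≤ R * (2 * M) := mul_le_mul hδR (by linarith) hA0 hR.le
  linarith

end Landau

section Montel

open Metric

theorem norm_sub_le_mul_chordalDist (z w : ℂ) :
    ‖z - w‖ ≤ (1 + ‖z‖) * (1 + ‖w‖) * chordalDist z w := by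
  have h1 : Real.sqrt ((1 + ‖z‖ ^ 2) * (1 + ‖w‖ ^ 2)) ≤ (1 + ‖z‖) * (1 + ‖w‖) := by
    rw [Real.sqrt_le_left (by positivity), mul_pow]
    gcongr <;> nlinarith [norm_nonneg z, norm_nonneg w]
  have h2 : 0 < Real.sqrt ((1 + ‖z‖ ^ 2) * (1 + ‖w‖ ^ 2)) := by positivity
  rw [chordalDist, mul_div_assoc', le_div_iff₀ h2, mul_comm ((1 + ‖z‖) * (1 + ‖w‖))]
  gcongr

/-- The chordal distance is the Euclidean distance between the images under stereographic
projection to a sphere of diameter one. -/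
theorem chordalDist_sq (z w : ℂ) :
    chordalDist z w ^ 2 = ‖(1 + ‖z‖ ^ 2)⁻¹ • z - (1 + ‖w‖ ^ 2)⁻¹ • w‖ ^ 2 +
      ((1 + ‖z‖ ^ 2)⁻¹ - (1 + ‖w‖ ^ 2)⁻¹) ^ 2 := by
  rw [chordalDist, div_pow, Real.sq_sqrt (by positivity)]
  simp only [Complex.sq_norm, Complex.normSq_apply, sub_re, sub_im, Complex.real_smul, mul_re,
    mul_im, ofReal_re, ofReal_im]
  have h1 : (0 : ℝ) < 1 + (z.re * z.re + z.im * z.im) := by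
    nlinarith [mul_self_nonneg z.re, mul_self_nonneg z.im]
  have h2 : (0 : ℝ) < 1 + (w.re * w.re + w.im * w.im) := by
    nlinarith [mul_self_nonneg w.re, mul_self_nonneg w.im]
  field_simp
  ring

theorem chordalDist_le_of_curve {γ γ' : ℝ → ℂ} {L : ℝ}
    (hγ : ∀ t ∈ Icc (0 : ℝ) 1, HasDerivAt γ (γ' t) t)
    (hL : ∀ t ∈ Icc (0 : ℝ) 1, ‖γ' t‖ * (1 + ‖γ t‖ ^ 2)⁻¹ ≤ L) :
    chordalDist (γ 1) (γ 0) ≤ 4 * L := by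
  set q : ℝ → ℝ := fun t => (1 + ‖γ t‖ ^ 2)⁻¹ with hq
  set q' : ℝ → ℝ := fun t => -(2 * inner ℝ (γ t) (γ' t)) / (1 + ‖γ t‖ ^ 2) ^ 2 with hq'
  have hqd : ∀ t ∈ Icc (0 : ℝ) 1, HasDerivAt q (q' t) t := fun t ht =>
    ((HasDerivAt.norm_sq (F := ℂ) (hγ t ht)).const_add 1).fun_inv (by positivity)
  have hγq : ∀ t, ‖γ t‖ ^ 2 * q t ≤ 1 := fun t => by
    rw [hq]; dsimp only
    rw [← div_eq_mul_inv]
    exact div_le_one_of_le₀ (by linarith) (by positivity)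
  have hq0 : ∀ t, 0 ≤ q t := fun t => by positivity
  have hq'le : ∀ t, |q' t| ≤ 2 * ‖γ t‖ * ‖γ' t‖ * q t ^ 2 := fun t => by
    rw [hq', hq]; dsimp only
    rw [abs_div, abs_neg, abs_mul, abs_two, abs_of_pos (by positivity : 0 < (1 + ‖γ t‖ ^ 2) ^ 2),
      inv_pow, div_eq_mul_inv, mul_assoc 2 ‖γ t‖]
    gcongr
    exact abs_real_inner_le_norm (γ t) (γ' t)
  have hL0 : 0 ≤ L := le_trans (by positivity) (hL 0 (by simp))
  have hq1 : ∀ t ∈ Icc (0 : ℝ) 1, ‖q' t‖ ≤ L := fun t ht => by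
    refine (hq'le t).trans ?_
    have h1 : 2 * ‖γ t‖ * q t ≤ 1 := by
      rw [hq]; dsimp only
      rw [← div_eq_mul_inv]
      exact div_le_one_of_le₀ (by nlinarith [sq_nonneg (‖γ t‖ - 1)]) (by positivity)
    calc 2 * ‖γ t‖ * ‖γ' t‖ * q t ^ 2 = (‖γ' t‖ * q t) * (2 * ‖γ t‖ * q t) := by ring
      _ ≤ L * 1 := mul_le_mul (hL t ht) h1 (by have := hq0 t; positivity) hL0
      _ = L := mul_one L
  have hp : ∀ t ∈ Icc (0 : ℝ) 1,
      HasDerivAt (fun t => q t • γ t) (q t • γ' t + q' t • γ t) t := fun t ht =>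
    (hqd t ht).fun_smul (hγ t ht)
  have hp1 : ∀ t ∈ Icc (0 : ℝ) 1, ‖q t • γ' t + q' t • γ t‖ ≤ 3 * L := fun t ht => by
    refine (norm_add_le _ _).trans ?_
    rw [norm_smul, norm_smul, Real.norm_of_nonneg (hq0 t), Real.norm_eq_abs]
    have h1 := hL t ht
    have h2 : |q' t| * ‖γ t‖ ≤ 2 * L := by
      calc |q' t| * ‖γ t‖ ≤ (2 * ‖γ t‖ * ‖γ' t‖ * q t ^ 2) * ‖γ t‖ := by gcongr; exact hq'le t
        _ = 2 * ((‖γ' t‖ * q t) * (‖γ t‖ ^ 2 * q t)) := by ring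
        _ ≤ 2 * (L * 1) := by
          gcongr
          exact hγq t
        _ = 2 * L := by ring
    have h3 : q t * ‖γ' t‖ ≤ L := by rw [mul_comm]; exact h1
    linarith
  have e1 := (convex_Icc (0 : ℝ) 1).norm_image_sub_le_of_norm_hasDerivWithin_le
    (fun t ht => (hqd t ht).hasDerivWithinAt) hq1 (left_mem_Icc.mpr zero_le_one)
    (right_mem_Icc.mpr zero_le_one)
  have e2 := (convex_Icc (0 : ℝ) 1).norm_image_sub_le_of_norm_hasDerivWithin_le
    (fun t ht => (hp t ht).hasDerivWithinAt) hp1 (left_mem_Icc.mpr zero_le_one)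
    (right_mem_Icc.mpr zero_le_one)
  rw [sub_zero, norm_one, mul_one] at e1 e2
  refine le_of_sq_le_sq ?_ (by positivity)
  rw [chordalDist_sq, ← sq_abs ((1 + ‖γ 1‖ ^ 2)⁻¹ - (1 + ‖γ 0‖ ^ 2)⁻¹)]
  have e1' : |q 1 - q 0| ^ 2 ≤ L ^ 2 := by gcongr; exact e1
  have e2' : ‖q 1 • γ 1 - q 0 • γ 0‖ ^ 2 ≤ (3 * L) ^ 2 := by gcongr
  nlinarith

theorem chordalDist_le_of_sphericalDeriv_le {F : ℂ → ℂ} {s : Set ℂ} {C : ℝ} (hs : Convex ℝ s)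
    (hF : ∀ z ∈ s, DifferentiableAt ℂ F z)
    (hC : ∀ z ∈ s, ‖deriv F z‖ * (1 + ‖F z‖ ^ 2)⁻¹ ≤ C) {w w' : ℂ} (hw : w ∈ s) (hw' : w' ∈ s) :
    chordalDist (F w) (F w') ≤ 4 * C * ‖w - w'‖ := by
  have hmem : ∀ t ∈ Icc (0 : ℝ) 1, w' + (t : ℂ) * (w - w') ∈ s := fun t ht => by
    have := hs.add_smul_sub_mem hw' hw ht
    rwa [Complex.real_smul] at this
  have h := chordalDist_le_of_curve (γ := fun t : ℝ => F (w' + (t : ℂ) * (w - w')))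
    (γ' := fun t : ℝ => deriv F (w' + (t : ℂ) * (w - w')) * (w - w')) (L := C * ‖w - w'‖)
    (fun t ht => by
      have h1 : HasDerivAt (fun t : ℝ => w' + (t : ℂ) * (w - w')) (w - w') t := by
        simpa using ((Complex.ofRealCLM.hasDerivAt (x := t)).mul_const (w - w')).const_add w'
      exact (hF _ (hmem t ht)).hasDerivAt.comp_of_eq t h1 rfl)
    (fun t ht => by
      rw [norm_mul, mul_right_comm]
      gcongr
      exact hC _ (hmem t ht))
  simp only [ofReal_one, one_mul, add_sub_cancel, ofReal_zero, zero_mul, add_zero] at h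
  linarith

theorem exists_differentiableOn_exp_eq {F : ℂ → ℂ} {c : ℂ} {r : ℝ} (hr : 0 < r)
    (hF : DifferentiableOn ℂ F (ball c r)) (h0 : ∀ z ∈ ball c r, F z ≠ 0) :
    ∃ U : ℂ → ℂ, DifferentiableOn ℂ U (ball c r) ∧ ∀ z ∈ ball c r, F z = Complex.exp (U z) := by
  have hq : DifferentiableOn ℂ (fun z => deriv F z / F z) (ball c r) :=
    (hF.deriv isOpen_ball).fun_div hF h0
  obtain ⟨U, hUc, hU⟩ := hq.isExactOn_ball.with_val_at c (Complex.log (F c))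
  refine ⟨U, fun z hz => (hU z hz).differentiableAt.differentiableWithinAt, fun z hz => ?_⟩
  have hc := mem_ball_self (x := c) hr
  have hd : ∀ z ∈ ball c r, HasDerivAt (fun z => F z * Complex.exp (-U z)) 0 z := fun z hz => by
    have h1 := ((hF.differentiableAt (isOpen_ball.mem_nhds hz)).hasDerivAt).fun_mul
      (hU z hz).fun_neg.cexp
    refine h1.congr_deriv ?_
    have := h0 z hz
    field_simp
    ring
  have h2 := isOpen_ball.is_const_of_deriv_eq_zero (convex_ball c r).isPreconnected
    (fun z hz => (hd z hz).differentiableAt.differentiableWithinAt)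
    (fun z hz => (hd z hz).deriv) hz hc
  rw [hUc, Complex.exp_neg, Complex.exp_neg, Complex.exp_log (h0 c hc),
    mul_inv_cancel₀ (h0 c hc)] at h2
  exact (mul_inv_eq_one₀ (Complex.exp_ne_zero _)).mp h2

theorem norm_deriv_le_of_exp_ne_one {U : ℂ → ℂ} {s : ℂ} {R : ℝ} (hR : 0 < R)
    (hU : DifferentiableOn ℂ U (ball s (3 * R)))
    (h1 : ∀ z ∈ ball s (3 * R), Complex.exp (U z) ≠ 1) :
    ‖deriv U s‖ ≤ (32768 + 2 * |(U s).re|) / R := by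
  have hdiff : ∀ z ∈ ball s (3 * R), DifferentiableAt ℂ U z := fun z hz =>
    hU.differentiableAt (isOpen_ball.mem_nhds hz)
  by_cases h : ∀ z ∈ ball s R, (U z).re ≠ 0
  · refine (norm_deriv_le_of_re_ne_zero hR (hU.mono (ball_subset_ball (by linarith))) h).trans ?_
    gcongr
    linarith
  · push Not at h
    obtain ⟨s₁, hs₁, h₁⟩ := h
    rw [mem_ball] at hs₁
    obtain ⟨p, hp0, hp1, hp2⟩ := exists_re_eq_zero_norm_deriv_le (U := U) (s := s) (s₁ := s₁)
      (fun z hz => hdiff z (mem_ball.mpr (by rw [mem_closedBall] at hz; linarith))) h₁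
    have hsub : closedBall p R ⊆ ball s (3 * R) := fun z hz => by
      rw [mem_closedBall] at hz
      rw [mem_ball]
      linarith [dist_triangle z p s]
    have h2 := norm_deriv_le_of_norm_deriv_le_at_period (M := 0) hR
      (fun z hz => hU.analyticAt (isOpen_ball.mem_nhds (hsub hz)))
      (fun z hz k hk => absurd (by rw [hk, Complex.exp_int_mul_two_pi_mul_I]) (h1 z (hsub hz))) hp0
    simp only [mul_zero, zero_mul] at h2
    rw [max_eq_left (by norm_num)] at h2
    rw [le_div_iff₀ hR]
    nlinarith [abs_nonneg (U s).re]

theorem exp_mul_add_abs_le (x : ℝ) :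
    Real.exp x * (32768 + 2 * |x|) ≤ 32770 * (1 + Real.exp x ^ 2) := by
  have ht := Real.exp_pos x
  have h1 : Real.exp x * |x| ≤ 1 + Real.exp x ^ 2 := by
    rcases le_total 0 x with hx | hx
    · rw [abs_of_nonneg hx]
      nlinarith [Real.add_one_le_exp x]
    · rw [abs_of_nonpos hx]
      have h2 : Real.exp x * Real.exp (-x) = 1 := by rw [← Real.exp_add]; simp
      nlinarith [Real.add_one_le_exp (-x)]
  nlinarith [sq_nonneg (Real.exp x - 1)]

/-- A quantitative form of Montel's theorem for holomorphic functions omitting `0` and `a`. -/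
theorem chordalDist_le_of_omits {F : ℂ → ℂ} {z₀ a : ℂ} {R : ℝ} (hR : 0 < R) (ha : a ≠ 0)
    (hF : DifferentiableOn ℂ F (ball z₀ (4 * R))) (h0 : ∀ z ∈ ball z₀ (4 * R), F z ≠ 0)
    (hFa : ∀ z ∈ ball z₀ (4 * R), F z ≠ a) {w w' : ℂ} (hw : w ∈ ball z₀ R)
    (hw' : w' ∈ ball z₀ R) :
    chordalDist (F w) (F w') ≤ 4 * ((‖a‖ + ‖a‖⁻¹) * 32770 / R) * ‖w - w'‖ := by
  obtain ⟨U, hU, hFU⟩ := exists_differentiableOn_exp_eq (F := fun z => F z / a) (by positivity)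
    (hF.div_const a) (fun z hz => div_ne_zero (h0 z hz) ha)
  have hsub : ball z₀ R ⊆ ball z₀ (4 * R) := ball_subset_ball (by linarith)
  refine chordalDist_le_of_sphericalDeriv_le (convex_ball z₀ R)
    (fun z hz => hF.differentiableAt (isOpen_ball.mem_nhds (hsub hz))) (fun z hz => ?_) hw hw'
  have hsub3 : ball z (3 * R) ⊆ ball z₀ (4 * R) := fun y hy => by
    rw [mem_ball] at *
    linarith [dist_triangle y z z₀]
  have h1 := norm_deriv_le_of_exp_ne_one hR (hU.mono hsub3) (fun y hy h => by
    rw [← hFU y (hsub3 hy), div_eq_one_iff_eq ha] at h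
    exact hFa y (hsub3 hy) h)
  have hFe : ∀ y ∈ ball z₀ (4 * R), F y = a * Complex.exp (U y) := fun y hy => by
    rw [← hFU y hy, mul_div_cancel₀ _ ha]
  have hd : HasDerivAt F (a * (Complex.exp (U z) * deriv U z)) z :=
    (((hU.differentiableAt (isOpen_ball.mem_nhds (hsub hz))).hasDerivAt.cexp).const_mul
      a).congr_of_eventuallyEq (eventually_of_mem (isOpen_ball.mem_nhds (hsub hz)) hFe)
  rw [hd.deriv, hFe z (hsub hz), norm_mul, norm_mul, norm_mul, Complex.norm_exp]
  set t := Real.exp (U z).re with ht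
  have ht0 : 0 < t := Real.exp_pos _
  have hα : 0 < ‖a‖ := norm_pos_iff.mpr ha
  have h2 : ‖a‖ * (1 + t ^ 2) ≤ (‖a‖ + ‖a‖⁻¹) * (1 + (‖a‖ * t) ^ 2) := by
    have : (‖a‖ + ‖a‖⁻¹) * (1 + (‖a‖ * t) ^ 2) =
        ‖a‖ * (1 + t ^ 2) + (‖a‖⁻¹ + ‖a‖ ^ 3 * t ^ 2) := by field_simp; ring
    rw [this]
    have : 0 ≤ ‖a‖⁻¹ + ‖a‖ ^ 3 * t ^ 2 := by positivity
    linarith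
  rw [← div_eq_mul_inv, div_le_div_iff₀ (by positivity) hR]
  calc ‖a‖ * (t * ‖deriv U z‖) * R
      ≤ ‖a‖ * (t * ((32768 + 2 * |(U z).re|) / R)) * R := by gcongr
    _ = ‖a‖ * (t * (32768 + 2 * |(U z).re|)) := by field_simp
    _ ≤ ‖a‖ * (32770 * (1 + t ^ 2)) :=
      mul_le_mul_of_nonneg_left (exp_mul_add_abs_le _) hα.le
    _ = 32770 * (‖a‖ * (1 + t ^ 2)) := by ring
    _ ≤ 32770 * ((‖a‖ + ‖a‖⁻¹) * (1 + (‖a‖ * t) ^ 2)) := by gcongr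
    _ = (‖a‖ + ‖a‖⁻¹) * 32770 * (1 + (‖a‖ * t) ^ 2) := by ring

end Montel

section PuncturedPlane

open Metric

theorem IsTranscendentalSelfMapCStar.ne_zero {f : ℂ → ℂ} (hf : IsTranscendentalSelfMapCStar f)
    {z : ℂ} (hz : z ≠ 0) : f z ≠ 0 := by
  obtain ⟨m, g, h, -, -, -, -, hfe⟩ := hf
  rw [hfe z hz]
  exact mul_ne_zero (zpow_ne_zero _ hz) (Complex.exp_ne_zero _)

theorem IsTranscendentalSelfMapCStar.differentiableAt {f : ℂ → ℂ}
    (hf : IsTranscendentalSelfMapCStar f) {z : ℂ} (hz : z ≠ 0) : DifferentiableAt ℂ f z := by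
  obtain ⟨m, g, h, hg, hh, -, -, hfe⟩ := hf
  have h1 : DifferentiableAt ℂ (fun z => z ^ m * Complex.exp (g z + h z⁻¹)) z :=
    (differentiableAt_zpow.mpr (Or.inl hz)).fun_mul
      (((hg z).fun_add ((hh z⁻¹).fun_comp' z (differentiableAt_inv hz))).cexp)
  exact h1.congr_of_eventuallyEq (eventually_of_mem (isOpen_ne.mem_nhds hz) hfe)

theorem IsTranscendentalSelfMapCStar.iterate_ne_zero {f : ℂ → ℂ}
    (hf : IsTranscendentalSelfMapCStar f) {z : ℂ} (hz : z ≠ 0) (n : ℕ) : f^[n] z ≠ 0 := by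
  induction n with
  | zero => exact hz
  | succ n ih => rw [Function.iterate_succ_apply']; exact hf.ne_zero ih

theorem IsTranscendentalSelfMapCStar.differentiableAt_iterate {f : ℂ → ℂ}
    (hf : IsTranscendentalSelfMapCStar f) {z : ℂ} (hz : z ≠ 0) (n : ℕ) :
    DifferentiableAt ℂ f^[n] z := by
  induction n with
  | zero => exact differentiableAt_id
  | succ n ih =>
    rw [Function.iterate_succ']
    exact (hf.differentiableAt (hf.iterate_ne_zero hz n)).comp z ih

theorem IsTranscendentalSelfMapCStar.norm_deriv_le_one_of_mem_fatouSet {f : ℂ → ℂ}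
    (hf : IsTranscendentalSelfMapCStar f) {p : ℂ} (hp : p ∈ FatouSet f) (hfp : f p = p) :
    ‖deriv f p‖ ≤ 1 := by
  obtain ⟨hp0, V, hVo, hpV, hV0, hV⟩ := hp
  have hfix : ∀ n, f^[n] p = p := fun n => Function.iterate_fixed hfp n
  obtain ⟨δ, hδ, hVδ⟩ := hV p hpV ((1 + ‖p‖) * (2 + ‖p‖))⁻¹ (by positivity)
  obtain ⟨r, hr, hrV⟩ := Metric.isOpen_iff.mp hVo p hpV
  set ρ := min r δ with hρ
  have hρ0 : 0 < ρ := lt_min hr hδ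
  have hchord : ∀ z w : ℂ, chordalDist z w ≤ ‖z - w‖ := fun z w => by
    refine div_le_self (norm_nonneg _) (Real.one_le_sqrt.mpr ?_)
    exact one_le_mul_of_one_le_of_one_le (by nlinarith [norm_nonneg z])
      (by nlinarith [norm_nonneg w])
  have hmaps : ∀ n, MapsTo f^[n] (ball p ρ) (closedBall (f^[n] p) 1) := fun n z hz => by
    have hz1 : z ∈ V := hrV (ball_subset_ball (min_le_left _ _) hz)
    have hz2 : chordalDist p z < δ := by
      refine (hchord p z).trans_lt ?_
      rw [← dist_eq_norm, dist_comm]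
      exact lt_of_lt_of_le hz (min_le_right _ _)
    have h1 := hVδ z hz1 hz2 n
    rw [hfix] at h1 ⊢
    set w := f^[n] z
    have h2 := norm_sub_le_mul_chordalDist p w
    have h3 : ‖w‖ ≤ ‖p‖ + ‖p - w‖ := by
      have := norm_sub_norm_le w p
      rw [norm_sub_rev] at this
      linarith
    rw [mem_closedBall, dist_comm, dist_eq_norm]
    by_contra! hlt
    have hpos : 0 < (1 + ‖p‖) * (2 + ‖p‖) := by positivity
    have h4 : (1 + ‖p‖) * (1 + ‖w‖) ≤ (1 + ‖p‖) * (2 + ‖p‖) * ‖p - w‖ := by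
      rw [mul_assoc]
      gcongr
      nlinarith [norm_nonneg p]
    have h5 : (1 + ‖p‖) * (1 + ‖w‖) * chordalDist p w <
        (1 + ‖p‖) * (2 + ‖p‖) * ‖p - w‖ * ((1 + ‖p‖) * (2 + ‖p‖))⁻¹ :=
      mul_lt_mul'' (lt_of_le_of_ne h4 ?_) h1 (by positivity) (by unfold chordalDist; positivity)
    · have h6 : (1 + ‖p‖) * (2 + ‖p‖) * ‖p - w‖ * ((1 + ‖p‖) * (2 + ‖p‖))⁻¹ = ‖p - w‖ := by
        field_simp
      linarith
    · intro heq
      have h7 : (1 + ‖w‖) = (2 + ‖p‖) * ‖p - w‖ := by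
        rw [mul_assoc] at heq
        exact mul_left_cancel₀ (by positivity) heq
      nlinarith [norm_nonneg p]
  have hbound : ∀ n, ‖deriv f p‖ ^ n ≤ 1 / ρ := fun n => by
    have hd : DifferentiableOn ℂ f^[n] (ball p ρ) := fun z hz =>
      (hf.differentiableAt_iterate
        (hV0 z (hrV (ball_subset_ball (min_le_left _ _) hz))) n).differentiableWithinAt
    have h1 := Complex.norm_deriv_le_div_of_mapsTo_ball hd (hmaps n) hρ0
    rwa [((hf.differentiableAt hp0).hasDerivAt.iterate p hfp n).deriv, norm_pow] at h1
  by_contra! hlt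
  obtain ⟨n, hn⟩ := pow_unbounded_of_one_lt (1 / ρ) hlt
  exact absurd (hbound n) (not_le.mpr hn)

/-- An entire function `U` with `U'` bounded on the set where `exp U = 1` is affine. -/
theorem exists_deriv_eq_const_of_norm_deriv_le_at_period {U : ℂ → ℂ} (hU : Differentiable ℂ U)
    {M : ℝ} (hM : ∀ z, ∀ k : ℤ, U z = k * (2 * Real.pi * I) → ‖deriv U z‖ ≤ M) :
    ∃ c, ∀ z, deriv U z = c := by
  have hZ : ∀ s, (U s).re = 0 → ‖deriv U s‖ ≤ max 4096 (2 * M) := fun s hs => by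
    simpa using norm_deriv_le_of_norm_deriv_le_at_period one_pos
      (fun z _ => hU.analyticAt z) (fun z _ => hM z) hs
  have hbd : ∃ B, ∀ z, ‖deriv U z‖ ≤ B := by
    by_cases h : ∀ z, (U z).re ≠ 0
    · refine ⟨0, fun z => ?_⟩
      have h1 : ∀ d : ℝ, 0 < d → ‖deriv U z‖ ≤ 2 * |(U z).re| / d := fun d hd =>
        norm_deriv_le_of_re_ne_zero hd hU.differentiableOn (fun w _ => h w)
      have ht : Tendsto (fun d : ℝ => 2 * |(U z).re| / d) atTop (𝓝 0) :=
        tendsto_const_nhds.div_atTop tendsto_id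
      refine ge_of_tendsto ht ?_
      filter_upwards [eventually_gt_atTop 0] with d hd using h1 d hd
    · push Not at h
      obtain ⟨s₁, hs₁⟩ := h
      refine ⟨8 * max 4096 (2 * M), fun z => ?_⟩
      obtain ⟨p, hp0, -, hp⟩ := exists_re_eq_zero_norm_deriv_le (U := U) (s := z) (s₁ := s₁)
        (fun w _ => hU w) hs₁
      linarith [hZ p hp0]
  obtain ⟨B, hB⟩ := hbd
  refine ⟨deriv U 0, fun z => ?_⟩
  refine hU.deriv.apply_eq_apply_of_bounded ?_ z 0
  exact isBounded_iff_forall_norm_le.mpr ⟨B, by rintro _ ⟨w, rfl⟩; exact hB w⟩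

theorem eq_const_of_add_comp_inv_eq_const {g h : ℂ → ℂ} (hg : Differentiable ℂ g)
    (hh : Differentiable ℂ h) {c : ℂ} (hgh : ∀ z : ℂ, z ≠ 0 → g z + h z⁻¹ = c) :
    ∃ c', ∀ z, g z = c' := by
  refine ⟨g 0, fun z => hg.apply_eq_apply_of_bounded ?_ z 0⟩
  obtain ⟨A, hA⟩ := (isCompact_closedBall (0 : ℂ) 1).exists_bound_of_continuousOn
    hg.continuous.continuousOn
  obtain ⟨B, hB⟩ := (isCompact_closedBall (0 : ℂ) 1).exists_bound_of_continuousOn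
    hh.continuous.continuousOn
  refine isBounded_iff_forall_norm_le.mpr ⟨max A (‖c‖ + B), ?_⟩
  rintro _ ⟨w, rfl⟩
  rcases le_total ‖w‖ 1 with hw | hw
  · exact le_max_of_le_left (hA w (by simpa using hw))
  · have hw0 : w ≠ 0 := norm_pos_iff.mp (by linarith)
    refine le_max_of_le_right ?_
    rw [eq_sub_of_add_eq (hgh w hw0)]
    refine (norm_sub_le _ _).trans ?_
    gcongr
    exact hB _ (by simpa using inv_le_one_of_one_le₀ hw)

theorem IsTranscendentalSelfMapCStar.exists_repelling_fixedPoint {f : ℂ → ℂ}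
    (hf : IsTranscendentalSelfMapCStar f) : ∃ p, p ≠ 0 ∧ f p = p ∧ 1 < ‖deriv f p‖ := by
  have hfd : ∀ z, z ≠ 0 → DifferentiableAt ℂ f z := fun z hz => hf.differentiableAt hz
  obtain ⟨m, g, h, hg, hh, hgc, -, hfe⟩ := hf
  by_contra! hno
  set U : ℂ → ℂ := fun s => (m - 1) * s + (g (Complex.exp s) + h (Complex.exp (-s))) with hUdef
  have hU : Differentiable ℂ U := by
    have h1 : Differentiable ℂ fun s => g (Complex.exp s) := hg.comp Complex.differentiable_exp
    have h2 : Differentiable ℂ fun s => h (Complex.exp (-s)) :=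
      hh.comp (Complex.differentiable_exp.comp differentiable_neg)
    exact (differentiable_id.const_mul _).add (h1.add h2)
  have hfU : ∀ s, f (Complex.exp s) = Complex.exp (s + U s) := fun s => by
    rw [hfe _ (Complex.exp_ne_zero s), ← Complex.exp_int_mul, ← Complex.exp_neg, ← Complex.exp_add,
      hUdef]
    ring_nf
  have hM : ∀ s, ∀ k : ℤ, U s = k * (2 * Real.pi * I) → ‖deriv U s‖ ≤ 2 := by
    intro s k hk
    have hfix : f (Complex.exp s) = Complex.exp s := by
      rw [hfU, Complex.exp_add, hk, Complex.exp_int_mul_two_pi_mul_I, mul_one]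
    have h1 : HasDerivAt (fun s => f (Complex.exp s))
        (deriv f (Complex.exp s) * Complex.exp s) s :=
      (hfd _ (Complex.exp_ne_zero s)).hasDerivAt.comp s (Complex.hasDerivAt_exp s)
    have h2 : HasDerivAt (fun s => Complex.exp (s + U s))
        (Complex.exp (s + U s) * (1 + deriv U s)) s :=
      ((hasDerivAt_id s).fun_add (hU s).hasDerivAt).cexp
    rw [← funext hfU] at h2
    have h3 := h1.unique h2
    rw [← hfU, hfix, mul_comm] at h3
    have h4 := mul_left_cancel₀ (Complex.exp_ne_zero s) h3
    have h5 := hno _ (Complex.exp_ne_zero s) hfix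
    rw [h4] at h5
    have h6 := norm_sub_le (1 + deriv U s) 1
    rw [add_sub_cancel_left, norm_one] at h6
    linarith
  obtain ⟨c, hc⟩ := exists_deriv_eq_const_of_norm_deriv_le_at_period hU hM
  have haff : ∀ s, U s - c * s = U 0 := fun s => by
    have hd : ∀ s, HasDerivAt (fun s => U s - c * s) 0 s := fun s => by
      have := (hU s).hasDerivAt.fun_sub ((hasDerivAt_id s).const_mul c)
      rw [hc s, mul_one, sub_self] at this
      exact this
    have := is_const_of_deriv_eq_zero (fun s => (hd s).differentiableAt) (fun s => (hd s).deriv) s 0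
    simpa using this
  have hcm : c = m - 1 := by
    have h1 := haff (2 * Real.pi * I)
    simp only [hUdef, Complex.exp_neg, Complex.exp_two_pi_mul_I, Complex.exp_zero, mul_zero,
      zero_add] at h1
    have h2 : ((m : ℂ) - 1 - c) * (2 * Real.pi * I) = 0 := by linear_combination h1
    rcases mul_eq_zero.mp h2 with h3 | h3
    · linear_combination -h3
    · exact absurd h3 Complex.two_pi_I_ne_zero
  refine hgc (eq_const_of_add_comp_inv_eq_const hg hh (c := U 0) fun z hz => ?_)
  have h1 := haff (Complex.log z)
  simp only [hcm, hUdef, Complex.exp_neg, Complex.exp_log hz] at h1 ⊢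
  linear_combination h1

theorem IsTranscendentalSelfMapCStar.juliaSet_nonempty {f : ℂ → ℂ}
    (hf : IsTranscendentalSelfMapCStar f) : (JuliaSet f).Nonempty := by
  obtain ⟨p, hp0, hfp, hp1⟩ := hf.exists_repelling_fixedPoint
  exact ⟨p, hp0, fun hp => absurd (hf.norm_deriv_le_one_of_mem_fatouSet hp hfp) (not_le.mpr hp1)⟩

theorem IsTranscendentalSelfMapCStar.mem_fatouSet_of_omits {f : ℂ → ℂ}
    (hf : IsTranscendentalSelfMapCStar f) {z a b : ℂ} (ha : a ≠ 0) (hb : b ≠ 0) {R : ℝ}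
    (hR : 0 < R) (hball : ∀ w ∈ ball z (4 * R), w ≠ 0)
    (hom : ∀ n : ℕ, (∀ w ∈ ball z (4 * R), f^[n] w ≠ a) ∨ ∀ w ∈ ball z (4 * R), f^[n] w ≠ b) :
    z ∈ FatouSet f := by
  have hsub : ball z R ⊆ ball z (4 * R) := ball_subset_ball (by linarith)
  set C : ℂ → ℝ := fun a => 4 * ((‖a‖ + ‖a‖⁻¹) * 32770 / R) with hC
  have hC0 : ∀ a, 0 ≤ C a := fun a => by positivity
  have hlip : ∀ n : ℕ, ∀ w ∈ ball z R, ∀ w' ∈ ball z R,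
      chordalDist (f^[n] w) (f^[n] w') ≤ (C a + C b) * ‖w - w'‖ := by
    intro n w hw w' hw'
    have hd : DifferentiableOn ℂ f^[n] (ball z (4 * R)) := fun y hy =>
      (hf.differentiableAt_iterate (hball y hy) n).differentiableWithinAt
    have h0 : ∀ y ∈ ball z (4 * R), f^[n] y ≠ 0 := fun y hy => hf.iterate_ne_zero (hball y hy) n
    rcases hom n with h | h
    · refine (chordalDist_le_of_omits hR ha hd h0 h hw hw').trans ?_
      gcongr
      exact le_add_of_nonneg_right (hC0 b)
    · refine (chordalDist_le_of_omits hR hb hd h0 h hw hw').trans ?_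
      gcongr
      exact le_add_of_nonneg_left (hC0 a)
  refine ⟨hball z (mem_ball_self (by positivity)), ball z R, isOpen_ball, mem_ball_self hR,
    fun w hw => hball w (hsub hw), fun w hw ε hε => ?_⟩
  set B := 1 + (‖z‖ + R) with hB
  have hBw : ∀ y ∈ ball z R, 1 + ‖y‖ ≤ B := fun y hy => by
    rw [mem_ball, dist_eq_norm] at hy
    linarith [norm_sub_norm_le y z]
  have hK : 0 < (C a + C b + 1) * (B * B) := by
    have := hC0 a
    have := hC0 b
    positivity
  refine ⟨ε / ((C a + C b + 1) * (B * B)), div_pos hε hK, fun w' hw' hlt n => ?_⟩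
  rw [lt_div_iff₀ hK] at hlt
  refine lt_of_le_of_lt ?_ hlt
  have h1 : ‖w - w'‖ ≤ B * B * chordalDist w w' := by
    refine (norm_sub_le_mul_chordalDist w w').trans ?_
    have : 0 ≤ chordalDist w w' := by unfold chordalDist; positivity
    gcongr
    · exact hBw w hw
    · exact hBw w' hw'
  calc chordalDist (f^[n] w) (f^[n] w') ≤ (C a + C b) * ‖w - w'‖ := hlip n w hw w' hw'
    _ ≤ (C a + C b + 1) * (B * B * chordalDist w w') := by
      have ha0 := hC0 a
      have hb0 := hC0 b
      exact mul_le_mul (by linarith) h1 (norm_nonneg _) (by linarith)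
    _ = chordalDist w w' * ((C a + C b + 1) * (B * B)) := by ring

end PuncturedPlane

/-- Let `f` be a transcendental self-map of `ℂ*` and let `E ⊆ ℂ*` be
completely invariant with `J(f)` equal to the closure in `ℂ*` of `E ∩ J(f)`. If `E` is not
connected, then `E` has infinitely many connected components. -/
theorem completely_invariant_disconnected_infinite_components (f : ℂ → ℂ)
    (hf : IsTranscendentalSelfMapCStar f) (E : Set ℂ)
    (hE : E ⊆ {z : ℂ | z ≠ 0})
    (hinv : ∀ z : ℂ, z ≠ 0 → (z ∈ E ↔ f z ∈ E))
    (hJ : JuliaSet f = closure (E ∩ JuliaSet f) \ {0})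
    (hdisc : ¬ IsPreconnected E) :
    Infinite (ConnectedComponents ↥E) := by
  by_contra hfin
  rw [not_infinite_iff_finite] at hfin
  obtain ⟨a, b, hab⟩ : ∃ a b : E, connectedComponent a ≠ connectedComponent b := by
    by_contra! hall
    refine hdisc (isPreconnected_iff_preconnectedSpace.mpr
      (preconnectedSpace_iff_connectedComponent.mpr fun x => eq_univ_of_forall fun y => ?_))
    rw [hall x y]
    exact mem_connectedComponent
  obtain ⟨z, hzE, hzJ⟩ : (E ∩ JuliaSet f).Nonempty := by
    obtain ⟨p, hp⟩ := hf.juliaSet_nonempty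
    rw [hJ] at hp
    exact closure_nonempty_iff.mp ⟨p, hp.1⟩
  have hopen : IsOpen (connectedComponent (⟨z, hzE⟩ : E)) :=
    ConnectedComponents.discreteTopology_iff.mp inferInstance _
  obtain ⟨V, hVo, hV⟩ := isOpen_induced_iff.mp hopen
  have hzV : z ∈ V ∩ {w | w ≠ 0} := by
    have : (⟨z, hzE⟩ : E) ∈ Subtype.val ⁻¹' V := hV ▸ mem_connectedComponent
    exact ⟨this, hE hzE⟩
  obtain ⟨r, hr, hrV⟩ := Metric.isOpen_iff.mp (hVo.inter isOpen_ne) z hzV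
  have hmaps : MapsTo f E E := fun w hw => (hinv w (hE hw)).mp hw
  have hcont : ContinuousOn f E := fun w hw =>
    (hf.differentiableAt (hE hw)).continuousAt.continuousWithinAt
  have hcontn : ∀ n, Continuous ((hmaps.restrict f E E)^[n]) := fun n =>
    (hcont.mapsToRestrict hmaps).iterate n
  have hback : ∀ n : ℕ, ∀ w, w ≠ 0 → f^[n] w ∈ E → w ∈ E := by
    intro n
    induction n with
    | zero => exact fun w _ h => h
    | succ n ih => exact fun w hw h => (hinv w hw).mpr (ih (f w) (hf.ne_zero hw) h)
  have hcomp : ∀ n : ℕ, ∀ w ∈ Metric.ball z r, ∀ c : E, f^[n] w = c →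
      connectedComponent c = connectedComponent ((hmaps.restrict f E E)^[n] ⟨z, hzE⟩) := by
    intro n w hw c hc
    have hwE : w ∈ E := hback n w (hrV hw).2 (hc ▸ c.2)
    have hwC : (⟨w, hwE⟩ : E) ∈ connectedComponent (⟨z, hzE⟩ : E) := by
      rw [← hV]
      exact (hrV hw).1
    have hcw : (hmaps.restrict f E E)^[n] ⟨w, hwE⟩ = c := by
      rw [hmaps.iterate_restrict n]
      exact Subtype.ext hc
    have := (hcontn n).image_connectedComponent_subset ⟨z, hzE⟩ (mem_image_of_mem _ hwC)
    rw [hcw] at this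
    exact (connectedComponent_eq this).symm
  refine hzJ.2 (hf.mem_fatouSet_of_omits (hE a.2) (hE b.2) (R := r / 4) (by positivity) ?_
    fun n => ?_)
  all_goals rw [mul_div_cancel₀ r four_ne_zero]
  · exact fun w hw => (hrV hw).2
  · by_contra! h
    obtain ⟨⟨w, hw, hwa⟩, w', hw', hwb⟩ := h
    exact hab ((hcomp n w hw a hwa).trans (hcomp n w' hw' b hwb).symm)
end
end
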